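/- arXiv:2104.00047 — 2 statements merged into one kernel-verified Lean document; each statement's English description precedes it below -/
import Mathlib

section
/- Under the standing assumptions, the following localized lower bound for the mean curvature holds at every (x,t) ∈ U × [0,T] with ψ(x,t) > 0: if α ≤ 1, then (H[u(·,t)](x))^α / ψ(x,t) ≥ inf{ (H[u(·,0)](y))^α / ψ(y,0) : y ∈ U, ψ(y,0) > 0 }; if α > 1, then (H[u(·,t)](x))^α / ψ(x,t) ≥ min{ inf{ (H[u(·,0)](y))^α / ψ(y,0) : y ∈ U, ψ(y,0) > 0 }, b/(a(α−1)) }. -/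
noncomputable section
open Set

abbrev En (n : ℕ) := EuclideanSpace ℝ (Fin n)

/-- Partial derivative `∂ᵢ f` at `x`. -/
noncomputable def pd {n : ℕ} (f : En n → ℝ) (i : Fin n) (x : En n) : ℝ :=
  fderiv ℝ f x (EuclideanSpace.single i 1)

/-- `|∇f|²` at `x`. -/
noncomputable def gradNormSq {n : ℕ} (f : En n → ℝ) (x : En n) : ℝ :=
  ∑ i : Fin n, (pd f i x) ^ 2

/-- `v(f) = √(1+|∇f|²)`. -/
noncomputable def graphV {n : ℕ} (f : En n → ℝ) (x : En n) : ℝ :=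
  Real.sqrt (1 + gradNormSq f x)

/-- Mean curvature `H[f] = div(∇f / v(f))` of `graph f`. -/
noncomputable def meanCurv {n : ℕ} (f : En n → ℝ) (x : En n) : ℝ :=
  ∑ i : Fin n, pd (fun y => pd f i y / graphV f y) i x


/-- The localization function `ψ(x,t) = (a − b·t − u(x,t))₊`. -/
noncomputable def psiF {n : ℕ} (a b : ℝ) (u : En n → ℝ → ℝ) (x : En n) (t : ℝ) : ℝ :=
  max (a - b * t - u x t) 0

/-- `w(x,t) = (1+|∇u(x,t)|²)^{-1/2}`. -/
noncomputable def wF {n : ℕ} (u : En n → ℝ → ℝ) (x : En n) (t : ℝ) : ℝ :=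
  1 / Real.sqrt (1 + gradNormSq (fun y => u y t) x)

def dd {E : Type*} [NormedAddCommGroup E] [NormedSpace ℝ E] (e : E) (g : E → ℝ) (p : E) : ℝ :=
  fderiv ℝ g p e

section calcu
variable {E : Type*} [NormedAddCommGroup E] [NormedSpace ℝ E]

lemma dd_congr {Ω : Set E} (hΩ : IsOpen Ω) {f g : E → ℝ} (h : ∀ p ∈ Ω, f p = g p) (e : E)
    {p : E} (hp : p ∈ Ω) : dd e f p = dd e g p := by
  unfold dd
  rw [Filter.EventuallyEq.fderiv_eq]
  filter_upwards [hΩ.mem_nhds hp] with q hq using h q hq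

lemma dd_smooth {Ω : Set E} (hΩ : IsOpen Ω) {g : E → ℝ} (hg : ContDiffOn ℝ (⊤ : ℕ∞) g Ω) (e : E) :
    ContDiffOn ℝ (⊤ : ℕ∞) (dd e g) Ω := by
  unfold dd
  exact (hg.fderiv_of_isOpen hΩ (by simp)).clm_apply contDiffOn_const

lemma sm_diff {Ω : Set E} (hΩ : IsOpen Ω) {g : E → ℝ} (hg : ContDiffOn ℝ (⊤ : ℕ∞) g Ω) {p : E}
    (hp : p ∈ Ω) : DifferentiableAt ℝ g p :=
  (hg.contDiffAt (hΩ.mem_nhds hp)).differentiableAt (by simp)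

lemma dd_comm {Ω : Set E} (hΩ : IsOpen Ω) {g : E → ℝ} (hg : ContDiffOn ℝ (⊤ : ℕ∞) g Ω) (e f : E)
    {p : E} (hp : p ∈ Ω) : dd e (dd f g) p = dd f (dd e g) p := by
  have h1 : DifferentiableAt ℝ (fderiv ℝ g) p :=
    ((hg.fderiv_of_isOpen hΩ (m := (⊤ : ℕ∞)) (by simp)).contDiffAt (hΩ.mem_nhds hp)).differentiableAt
      (by simp)
  have h2 : ∀ e f : E, dd e (dd f g) p = fderiv ℝ (fderiv ℝ g) p e f := by
    intro e f
    unfold dd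
    rw [fderiv_clm_apply h1 (differentiableAt_const _)]
    simp
  rw [h2, h2]
  have h3 : IsSymmSndFDerivAt ℝ g p :=
    (hg.contDiffAt (hΩ.mem_nhds hp)).isSymmSndFDerivAt
      (by simp only [minSmoothness_of_isRCLikeNormedField]; exact WithTop.coe_le_coe.2 (le_top : (2 : ℕ∞) ≤ ⊤))
  exact h3 e f

lemma dd_add {f g : E → ℝ} {p : E} (e : E) (hf : DifferentiableAt ℝ f p)
    (hg : DifferentiableAt ℝ g p) : dd e (fun q => f q + g q) p = dd e f p + dd e g p := by
  unfold dd; rw [fderiv_fun_add hf hg]; simp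

lemma dd_sub {f g : E → ℝ} {p : E} (e : E) (hf : DifferentiableAt ℝ f p)
    (hg : DifferentiableAt ℝ g p) : dd e (fun q => f q - g q) p = dd e f p - dd e g p := by
  unfold dd; rw [fderiv_fun_sub hf hg]; simp

lemma dd_mul {f g : E → ℝ} {p : E} (e : E) (hf : DifferentiableAt ℝ f p)
    (hg : DifferentiableAt ℝ g p) :
    dd e (fun q => f q * g q) p = dd e f p * g p + f p * dd e g p := by
  unfold dd; rw [fderiv_fun_mul hf hg]; simp; ring

lemma dd_sum {ι : Type*} [Fintype ι] {f : ι → E → ℝ} {p : E} (e : E)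
    (hf : ∀ i, DifferentiableAt ℝ (f i) p) :
    dd e (fun q => ∑ i, f i q) p = ∑ i, dd e (f i) p := by
  unfold dd; rw [fderiv_fun_sum (fun i _ => hf i)]; simp

/-- gradient length -/
def gV {n : ℕ} (e : Fin n → E) (u : E → ℝ) (p : E) : ℝ := Real.sqrt (1 + ∑ i, dd (e i) u p ^ 2)
def gN {n : ℕ} (e : Fin n → E) (u : E → ℝ) (i : Fin n) (p : E) : ℝ := dd (e i) u p / gV e u p
def gH {n : ℕ} (e : Fin n → E) (u : E → ℝ) (p : E) : ℝ := ∑ i, dd (e i) (gN e u i) p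

variable {n : ℕ} {e : Fin n → E} {u : E → ℝ} {Ω : Set E}

lemma gV_arg (e : Fin n → E) (u : E → ℝ) (p : E) : 0 < 1 + ∑ i, dd (e i) u p ^ 2 := by positivity

lemma gV_pos (e : Fin n → E) (u : E → ℝ) (p : E) : 0 < gV e u p := Real.sqrt_pos.2 (gV_arg e u p)

lemma gV_sq (e : Fin n → E) (u : E → ℝ) (p : E) : gV e u p ^ 2 = 1 + ∑ i, dd (e i) u p ^ 2 :=
  Real.sq_sqrt (gV_arg e u p).le

lemma gV_smooth (hΩ : IsOpen Ω) (hu : ContDiffOn ℝ (⊤ : ℕ∞) u Ω) :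
    ContDiffOn ℝ (⊤ : ℕ∞) (gV e u) Ω := by
  unfold gV
  apply ContDiffOn.sqrt
  · exact contDiffOn_const.add (ContDiffOn.sum fun i _ => (dd_smooth hΩ hu (e i)).pow 2)
  · intro p _; exact (gV_arg e u p).ne'

lemma gN_smooth (hΩ : IsOpen Ω) (hu : ContDiffOn ℝ (⊤ : ℕ∞) u Ω) (i : Fin n) :
    ContDiffOn ℝ (⊤ : ℕ∞) (gN e u i) Ω := by
  unfold gN
  exact (dd_smooth hΩ hu (e i)).div (gV_smooth hΩ hu) fun p _ => (gV_pos e u p).ne'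

lemma gH_smooth (hΩ : IsOpen Ω) (hu : ContDiffOn ℝ (⊤ : ℕ∞) u Ω) :
    ContDiffOn ℝ (⊤ : ℕ∞) (gH e u) Ω := by
  unfold gH
  exact ContDiffOn.sum fun i _ => dd_smooth hΩ (gN_smooth hΩ hu i) _

lemma gVN (e : Fin n → E) (u : E → ℝ) (i : Fin n) (p : E) :
    gV e u p * gN e u i p = dd (e i) u p := by
  unfold gN; field_simp [(gV_pos e u p).ne']

lemma dd_gV (hΩ : IsOpen Ω) (hu : ContDiffOn ℝ (⊤ : ℕ∞) u Ω) (f : E) {p : E} (hp : p ∈ Ω) :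
    dd f (gV e u) p = ∑ j, gN e u j p * dd f (dd (e j) u) p := by
  have hV := sm_diff hΩ (gV_smooth (e := e) hΩ hu) hp
  have hd : ∀ j, DifferentiableAt ℝ (dd (e j) u) p := fun j => sm_diff hΩ (dd_smooth hΩ hu _) hp
  have h1 : dd f (fun q => gV e u q * gV e u q) p
      = dd f (fun q => 1 + ∑ j, dd (e j) u q * dd (e j) u q) p := by
    congr 1; ext q; rw [← sq, gV_sq]; simp [sq]
  rw [dd_mul f hV hV, dd_add f (differentiableAt_const _)
    (DifferentiableAt.fun_sum fun j _ => (hd j).fun_mul (hd j)), dd_sum f (fun j => (hd j).fun_mul (hd j))] at h1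
  have h2 : dd f (fun _ : E => (1:ℝ)) p = 0 := by simp [dd]
  have h3 : ∀ j, dd f (fun q => dd (e j) u q * dd (e j) u q) p
      = 2 * gV e u p * (gN e u j p * dd f (dd (e j) u) p) := by
    intro j; rw [dd_mul f (hd j) (hd j), ← gVN]; ring
  have h4 : dd f (fun q => gV e u q) p = dd f (gV e u) p := rfl
  simp only [h2, h3, ← Finset.mul_sum] at h1
  have := gV_pos e u p
  have h5 : 2 * gV e u p * dd f (gV e u) p = 2 * gV e u p * ∑ j, gN e u j p * dd f (dd (e j) u) p := by
    linarith
  exact mul_left_cancel₀ (by positivity) h5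

lemma dd_gN (hΩ : IsOpen Ω) (hu : ContDiffOn ℝ (⊤ : ℕ∞) u Ω) (f : E) (i : Fin n) {p : E} (hp : p ∈ Ω) :
    gV e u p * dd f (gN e u i) p
      = dd f (dd (e i) u) p - gN e u i p * ∑ j, gN e u j p * dd f (dd (e j) u) p := by
  have hV := sm_diff hΩ (gV_smooth (e := e) hΩ hu) hp
  have hN := sm_diff hΩ (gN_smooth (e := e) hΩ hu i) hp
  have h1 : dd f (fun q => gV e u q * gN e u i q) p = dd f (dd (e i) u) p := by
    congr 1; ext q; exact gVN e u i q
  rw [dd_mul f hV hN, dd_gV hΩ hu f hp] at h1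
  linarith

lemma dt_gN (hΩ : IsOpen Ω) (hu : ContDiffOn ℝ (⊤ : ℕ∞) u Ω) {F : E → ℝ}
    (hF : ContDiffOn ℝ (⊤ : ℕ∞) F Ω) (et : E)
    (hflow : ∀ p ∈ Ω, dd et u p = gV e u p * F p) (i : Fin n) {p : E} (hp : p ∈ Ω) :
    dd et (gN e u i) p = dd (e i) F p - gN e u i p * ∑ j, gN e u j p * dd (e j) F p
      + F p * ∑ k, gN e u k p * dd (e k) (gN e u i) p := by
  have hV := sm_diff hΩ (gV_smooth (e := e) hΩ hu) hp
  have hF' := sm_diff hΩ hF hp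
  have hVp := gV_pos e u p
  apply mul_left_cancel₀ hVp.ne'
  rw [dd_gN hΩ hu et i hp]
  have h1 : ∀ j, dd et (dd (e j) u) p
      = gV e u p * dd (e j) F p + F p * ∑ k, gN e u k p * dd (e k) (dd (e j) u) p := by
    intro j
    rw [dd_comm hΩ hu _ _ hp, dd_congr hΩ hflow _ hp, dd_mul _ hV hF', dd_gV hΩ hu _ hp]
    have : ∀ k, dd (e j) (dd (e k) u) p = dd (e k) (dd (e j) u) p := fun k => dd_comm hΩ hu _ _ hp
    simp only [this]; ring
  have h2 : gV e u p * ∑ k, gN e u k p * dd (e k) (gN e u i) p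
      = ∑ k, gN e u k p * (dd (e k) (dd (e i) u) p
          - gN e u i p * ∑ j, gN e u j p * dd (e k) (dd (e j) u) p) := by
    rw [Finset.mul_sum]; refine Finset.sum_congr rfl fun k _ => ?_
    rw [← dd_gN hΩ hu _ i hp]; ring
  have h3 : ∑ k, gN e u k p * ∑ j, gN e u j p * dd (e k) (dd (e j) u) p
      = ∑ j, gN e u j p * ∑ k, gN e u k p * dd (e k) (dd (e j) u) p := by
    simp only [Finset.mul_sum]; rw [Finset.sum_comm]
    refine Finset.sum_congr rfl fun k _ => Finset.sum_congr rfl fun j _ => by ring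
  have h4 : ∑ k, gN e u k p * (dd (e k) (dd (e i) u) p
          - gN e u i p * ∑ j, gN e u j p * dd (e k) (dd (e j) u) p)
      = ∑ k, gN e u k p * dd (e k) (dd (e i) u) p
        - gN e u i p * ∑ j, gN e u j p * ∑ k, gN e u k p * dd (e k) (dd (e j) u) p := by
    rw [← h3, Finset.mul_sum, ← Finset.sum_sub_distrib]
    refine Finset.sum_congr rfl fun k _ => by ring
  have h5 : ∑ j, gN e u j p * dd et (dd (e j) u) p
      = gV e u p * ∑ j, gN e u j p * dd (e j) F p
        + F p * ∑ j, gN e u j p * ∑ k, gN e u k p * dd (e k) (dd (e j) u) p := by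
    rw [Finset.mul_sum, Finset.mul_sum, ← Finset.sum_add_distrib]
    refine Finset.sum_congr rfl fun k _ => by rw [h1]; ring
  rw [h5, h1 i]
  rw [h4] at h2
  linear_combination (-F p) * h2

lemma dt_gH (hΩ : IsOpen Ω) (hu : ContDiffOn ℝ (⊤ : ℕ∞) u Ω) {F : E → ℝ}
    (hF : ContDiffOn ℝ (⊤ : ℕ∞) F Ω) (et : E)
    (hflow : ∀ p ∈ Ω, dd et u p = gV e u p * F p) {p : E} (hp : p ∈ Ω) :
    dd et (gH e u) p = ∑ i, dd (e i) (dd (e i) F) p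
      - ∑ i, ∑ j, gN e u i p * gN e u j p * dd (e i) (dd (e j) F) p
      - gH e u p * ∑ j, gN e u j p * dd (e j) F p
      + F p * ∑ i, ∑ k, dd (e i) (gN e u k) p * dd (e k) (gN e u i) p
      + F p * ∑ k, gN e u k p * dd (e k) (gH e u) p := by
  have dF := sm_diff hΩ hF hp
  have dN : ∀ i, DifferentiableAt ℝ (gN e u i) p := fun i => sm_diff hΩ (gN_smooth hΩ hu i) hp
  have dDN : ∀ i f, DifferentiableAt ℝ (dd f (gN e u i)) p :=
    fun i f => sm_diff hΩ (dd_smooth hΩ (gN_smooth hΩ hu i) f) hp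
  have dDF : ∀ f, DifferentiableAt ℝ (dd f F) p := fun f => sm_diff hΩ (dd_smooth hΩ hF f) hp
  have hH : ∀ f, dd f (gH e u) p = ∑ i, dd f (dd (e i) (gN e u i)) p := by
    intro f; exact dd_sum f (fun i => dDN i (e i))
  have dS1 : DifferentiableAt ℝ (fun q => ∑ j, gN e u j q * dd (e j) F q) p :=
    DifferentiableAt.fun_sum fun j _ => (dN j).fun_mul (dDF _)
  have dS2 : ∀ i, DifferentiableAt ℝ (fun q => ∑ k, gN e u k q * dd (e k) (gN e u i) q) p :=
    fun i => DifferentiableAt.fun_sum fun j _ => (dN j).fun_mul (dDN i _)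
  have key : ∀ i, dd et (dd (e i) (gN e u i)) p =
      dd (e i) (dd (e i) F) p
      - (dd (e i) (gN e u i) p * ∑ j, gN e u j p * dd (e j) F p
        + gN e u i p * ∑ j, (dd (e i) (gN e u j) p * dd (e j) F p
            + gN e u j p * dd (e i) (dd (e j) F) p))
      + (dd (e i) F p * ∑ k, gN e u k p * dd (e k) (gN e u i) p
        + F p * ∑ k, (dd (e i) (gN e u k) p * dd (e k) (gN e u i) p
            + gN e u k p * dd (e k) (dd (e i) (gN e u i)) p)) := by
    intro i
    rw [dd_comm hΩ (gN_smooth hΩ hu i) _ _ hp,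
      dd_congr hΩ (fun q hq => dt_gN hΩ hu hF et hflow i hq) _ hp,
      dd_add _ ((dDF _).fun_sub ((dN i).fun_mul dS1)) (dF.fun_mul (dS2 i)),
      dd_sub _ (dDF _) ((dN i).fun_mul dS1), dd_mul _ (dN i) dS1, dd_mul _ dF (dS2 i),
      dd_sum _ (fun j => (dN j).fun_mul (dDF _)), dd_sum _ (fun j => (dN j).fun_mul (dDN i _))]
    congr 3
    · congr 1
      refine Finset.sum_congr rfl fun j _ => dd_mul _ (dN j) (dDF _)
    · refine Finset.sum_congr rfl fun j _ => ?_
      rw [dd_mul _ (dN j) (dDN i _), dd_comm hΩ (gN_smooth hΩ hu i) (e i) (e j) hp]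
  rw [hH]
  simp only [key, hH]
  have c1 : ∑ i, dd (e i) F p * ∑ k, gN e u k p * dd (e k) (gN e u i) p
      = ∑ i, gN e u i p * ∑ j, dd (e i) (gN e u j) p * dd (e j) F p := by
    simp only [Finset.mul_sum]; rw [Finset.sum_comm]
    refine Finset.sum_congr rfl fun k _ => Finset.sum_congr rfl fun j _ => by ring
  have c2 : ∑ i, ∑ k, gN e u k p * dd (e k) (dd (e i) (gN e u i)) p
      = ∑ k, gN e u k p * ∑ i, dd (e k) (dd (e i) (gN e u i)) p := by
    rw [Finset.sum_comm]; simp only [Finset.mul_sum]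
  have c3 : ∑ i, gN e u i p * ∑ j, gN e u j p * dd (e i) (dd (e j) F) p
      = ∑ i, ∑ j, gN e u i p * gN e u j p * dd (e i) (dd (e j) F) p := by
    simp only [Finset.mul_sum, mul_assoc]
  rw [← c2, ← c3]
  simp only [Finset.sum_add_distrib, Finset.sum_sub_distrib, mul_add, ← Finset.mul_sum,
    ← Finset.sum_mul] at c1 ⊢
  rw [c1]
  unfold gH
  ring

lemma R_sq {n : ℕ} (N : Fin n → ℝ) (w : ℝ) (hw : 0 < w) (hN : ∑ i, N i ^ 2 = 1 - w ^ 2)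
    (R : Matrix (Fin n) (Fin n) ℝ)
    (hR : R = 1 - (1 / (1 + w)) • Matrix.vecMulVec N N) :
    R * R = 1 - Matrix.vecMulVec N N ∧ R.transpose = R := by
  have hd : N ⬝ᵥ N = 1 - w ^ 2 := by rw [← hN]; simp [dotProduct, sq]
  have hsq : Matrix.vecMulVec N N * Matrix.vecMulVec N N = (1 - w ^ 2) • Matrix.vecMulVec N N := by
    rw [Matrix.vecMulVec_mul_vecMulVec, hd]
    ext i j; simp [Matrix.vecMulVec_apply]; ring
  constructor
  · rw [hR, sub_mul, mul_sub, mul_sub, one_mul, mul_one, one_mul, smul_mul_smul_comm, hsq, smul_smul]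
    have : (1 / (1 + w) * (1 / (1 + w)) * (1 - w ^ 2)) = 2 * (1 / (1 + w)) - 1 := by
      field_simp; ring
    rw [this, sub_smul, two_mul, add_smul, one_smul]
    abel
  · rw [hR]; ext i j; simp [Matrix.vecMulVec_apply, Matrix.one_apply, mul_comm, eq_comm]

lemma quad_nonneg {n : ℕ} (N : Fin n → ℝ) (w : ℝ) (hw : 0 < w) (hN : ∑ i, N i ^ 2 = 1 - w ^ 2)
    (h : Fin n → Fin n → ℝ) (hq : ∀ ξ : Fin n → ℝ, 0 ≤ ∑ i, ∑ j, ξ i * ξ j * h i j) :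
    0 ≤ ∑ i, h i i - ∑ i, ∑ j, N i * N j * h i j := by
  set R : Matrix (Fin n) (Fin n) ℝ := 1 - (1 / (1 + w)) • Matrix.vecMulVec N N with hR
  obtain ⟨h1, h2⟩ := R_sq N w hw hN R hR
  have h3 : ∀ i j, ∑ k, R k i * R k j = (1 : Matrix (Fin n) (Fin n) ℝ) i j - N i * N j := by
    intro i j
    have := congrFun (congrFun h1 i) j
    rw [Matrix.mul_apply] at this
    simp only [Matrix.sub_apply, Matrix.vecMulVec_apply] at this
    rw [← this]
    refine Finset.sum_congr rfl fun k _ => ?_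
    rw [← congrFun (congrFun h2 i) k]; rfl
  have h4 : 0 ≤ ∑ k, ∑ i, ∑ j, R k i * R k j * h i j := Finset.sum_nonneg fun k _ => hq (R k)
  have h5 : ∑ k, ∑ i, ∑ j, R k i * R k j * h i j = ∑ i, ∑ j, (∑ k, R k i * R k j) * h i j := by
    rw [Finset.sum_comm]
    refine Finset.sum_congr rfl fun i _ => ?_
    rw [Finset.sum_comm]
    refine Finset.sum_congr rfl fun j _ => ?_
    rw [Finset.sum_mul]
  rw [h5] at h4
  simp only [h3, sub_mul, Finset.sum_sub_distrib, Matrix.one_apply, ite_mul, one_mul, zero_mul,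
    Finset.sum_ite_eq, Finset.mem_univ, if_true] at h4
  exact h4

lemma trace_sq_pos {n : ℕ} (N : Fin n → ℝ) (w : ℝ) (hw : 0 < w) (hN : ∑ i, N i ^ 2 = 1 - w ^ 2)
    (P B : Fin n → Fin n → ℝ) (hP : ∀ i j, P i j = P j i)
    (hB : ∀ i k, B i k = w * (P i k - N k * ∑ j, N j * P i j)) (htr : 0 < ∑ i, B i i) :
    0 < ∑ i, ∑ k, B i k * B k i := by
  set R : Matrix (Fin n) (Fin n) ℝ := 1 - (1 / (1 + w)) • Matrix.vecMulVec N N with hR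
  obtain ⟨h1, h2⟩ := R_sq N w hw hN R hR
  set p : Matrix (Fin n) (Fin n) ℝ := Matrix.of P
  set M : Matrix (Fin n) (Fin n) ℝ := Matrix.of B with hM
  have hpT : p.transpose = p := by ext i j; exact hP j i
  have hBm : M = w • (p * (R * R)) := by
    rw [h1]; ext i k
    simp only [M, p, Matrix.of_apply, hB, mul_sub, Matrix.smul_apply, Matrix.sub_apply, mul_one,
      Matrix.mul_apply, Matrix.vecMulVec_apply, smul_eq_mul, Finset.mul_sum]
    congr 1
    refine Finset.sum_congr rfl fun k _ => by ring
  set C := R * p * R with hC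
  have hCT : C.transpose = C := by
    rw [hC, Matrix.transpose_mul, Matrix.transpose_mul, h2, hpT, Matrix.mul_assoc]
  have t1 : M.trace = w * C.trace := by
    rw [hBm, Matrix.trace_smul, hC, smul_eq_mul, Matrix.trace_mul_comm (R * p) R,
      ← Matrix.mul_assoc R R p, Matrix.trace_mul_comm p]
  have t2 : (M * M).trace = w ^ 2 * (C * C).trace := by
    rw [hBm, smul_mul_smul_comm, Matrix.trace_smul, smul_eq_mul, sq]
    congr 1
    rw [hC]
    have e1 : p * (R * R) * (p * (R * R)) = (p * R * (R * p * R)) * R := by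
      simp only [Matrix.mul_assoc]
    rw [e1, Matrix.trace_mul_comm]
    congr 1
    simp only [Matrix.mul_assoc]
  have t3 : M.trace = ∑ i, B i i := rfl
  have t4 : (M * M).trace = ∑ i, ∑ k, B i k * B k i := by
    simp [Matrix.trace, Matrix.mul_apply, M]
  have t5 : (C * C).trace = ∑ i, ∑ k, C i k ^ 2 := by
    simp only [Matrix.trace, Matrix.mul_apply, Matrix.diag_apply]
    refine Finset.sum_congr rfl fun i _ => Finset.sum_congr rfl fun k _ => ?_
    rw [sq]; congr 1; exact congrFun (congrFun hCT i) k
  rw [← t4, t2, t5]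
  have hn : 0 ≤ ∑ i, ∑ k, C i k ^ 2 := by positivity
  rcases hn.lt_or_eq with h | h
  · positivity
  · exfalso
    have hz : ∀ i, C i i = 0 := by
      intro i
      have a1 := (Finset.sum_eq_zero_iff_of_nonneg (fun i _ => by positivity)).1 h.symm i (Finset.mem_univ i)
      have a2 := (Finset.sum_eq_zero_iff_of_nonneg (fun i _ => by positivity)).1 a1 i (Finset.mem_univ i)
      exact pow_eq_zero_iff (two_ne_zero) |>.1 a2
    have : C.trace = 0 := by simp [Matrix.trace, hz]
    rw [← t3, t1, this] at htr
    simp at htr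

lemma dd_line (G : E → ℝ) (p ξ : E) (s : ℝ) (h : DifferentiableAt ℝ G (p + s • ξ)) :
    HasDerivAt (fun s : ℝ => G (p + s • ξ)) (dd ξ G (p + s • ξ)) s := by
  have h1 : HasDerivAt (fun s : ℝ => p + s • ξ) ξ s := by
    simpa using ((hasDerivAt_id s).smul_const ξ).const_add p
  exact h.hasFDerivAt.comp_hasDerivAt s h1

lemma second_test (hΩ : IsOpen Ω) {G : E → ℝ} (hG : ContDiffOn ℝ (⊤ : ℕ∞) G Ω) {p : E} (hp : p ∈ Ω)
    (ξ : E) (hmin : ∀ᶠ s in nhds (0:ℝ), G p ≤ G (p + s • ξ)) :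
    dd ξ G p = 0 ∧ 0 ≤ dd ξ (dd ξ G) p := by
  set φ : ℝ → ℝ := fun s => G (p + s • ξ) with hφ
  have hc : Continuous (fun s : ℝ => p + s • ξ) := by fun_prop
  have hmem : ∀ᶠ s in nhds (0:ℝ), p + s • ξ ∈ Ω :=
    hc.continuousAt.eventually_mem (by simpa using hΩ.mem_nhds hp)
  have hd1 : ∀ᶠ s in nhds (0:ℝ), deriv φ s = dd ξ G (p + s • ξ) := by
    filter_upwards [hmem] with s hs using (dd_line G p ξ s (sm_diff hΩ hG hs)).deriv
  have hd2 : deriv (deriv φ) 0 = dd ξ (dd ξ G) p := by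
    rw [Filter.EventuallyEq.deriv_eq hd1]
    have := (dd_line (dd ξ G) p ξ 0 (sm_diff hΩ (dd_smooth hΩ hG ξ) (by simpa using hp))).deriv
    simpa using this
  have hlm : IsLocalMin φ 0 := by
    filter_upwards [hmin] with s hs; simpa [hφ] using hs
  have hz : deriv φ 0 = 0 := hlm.deriv_eq_zero
  refine ⟨?_, ?_⟩
  · have := hd1.self_of_nhds; rw [hz] at this; simpa using this.symm
  · by_contra hneg
    push Not at hneg
    rw [← hd2] at hneg
    have hmax : IsLocalMax φ 0 := isLocalMax_of_deriv_deriv_neg hneg hz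
      (dd_line G p ξ 0 (sm_diff hΩ hG (by simpa using hp))).continuousAt
    have hconst : φ =ᶠ[nhds 0] fun _ => φ 0 := by
      filter_upwards [hlm, hmax] with s h1 h2 using le_antisymm h2 h1
    have : deriv (deriv φ) 0 = 0 := by
      rw [Filter.EventuallyEq.deriv_eq hconst.deriv]; simp
    linarith

lemma dd_lin (G : E → ℝ) (p : E) (ξ : Fin n → ℝ) :
    dd (∑ i, ξ i • e i) G p = ∑ i, ξ i * dd (e i) G p := by
  simp [dd]

lemma hess_lin (hΩ : IsOpen Ω) {G : E → ℝ} (hG : ContDiffOn ℝ (⊤ : ℕ∞) G Ω) {p : E} (hp : p ∈ Ω)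
    (ξ : Fin n → ℝ) :
    dd (∑ i, ξ i • e i) (dd (∑ i, ξ i • e i) G) p
      = ∑ i, ∑ j, ξ i * ξ j * dd (e i) (dd (e j) G) p := by
  have h0 : dd (∑ i, ξ i • e i) G = fun q => ∑ j, ξ j * dd (e j) G q := by
    ext q; exact dd_lin G q ξ
  have dDG : ∀ f, DifferentiableAt ℝ (dd f G) p := fun f => sm_diff hΩ (dd_smooth hΩ hG f) hp
  rw [h0, dd_lin]
  refine Finset.sum_congr rfl fun i _ => ?_
  rw [dd_sum _ (fun j => (differentiableAt_const _).fun_mul (dDG _)), Finset.mul_sum]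
  refine Finset.sum_congr rfl fun j _ => ?_
  rw [dd_mul _ (differentiableAt_const _) (dDG _)]
  have : dd (e i) (fun _ : E => ξ j) p = 0 := by simp [dd]
  rw [this]; ring

set_option maxHeartbeats 1000000 in
lemma touch_false (hΩ : IsOpen Ω) (hu : ContDiffOn ℝ (⊤ : ℕ∞) u Ω) (et : E) (α a b c ψ : ℝ)
    (hα : 0 < α) (ha : 0 < a) (hb : 0 ≤ b) (hc : 0 < c)
    (hH : ∀ p ∈ Ω, 0 < gH e u p)
    (hflow : ∀ p ∈ Ω, dd et u p = gV e u p * gH e u p ^ α) {p : E} (hp : p ∈ Ω)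
    (hmin : ∀ ξ : Fin n → ℝ, ∀ᶠ s in nhds (0:ℝ),
      gH e u p ^ α + c * u p ≤ gH e u (p + s • ∑ i, ξ i • e i) ^ α + c * u (p + s • ∑ i, ξ i • e i))
    (htime : dd et (fun q => gH e u q ^ α) p ≤ c * (-b - dd et u p))
    (hψ : gH e u p ^ α = c * ψ) (hψ0 : 0 < ψ) (hψa : ψ ≤ a)
    (hcase : α ≤ 1 ∨ (1 < α ∧ c < b / (a * (α - 1)))) : False := by
  set F : E → ℝ := fun q => gH e u q ^ α with hFdef
  have hHs := gH_smooth (e := e) hΩ hu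
  have hF : ContDiffOn ℝ (⊤ : ℕ∞) F Ω := hHs.rpow_const_of_ne fun q hq => (hH q hq).ne'
  have hG : ContDiffOn ℝ (⊤ : ℕ∞) (fun q => F q + c * u q) Ω := hF.add (contDiffOn_const.mul hu)
  have hVp := gV_pos e u p
  set V := gV e u p with hVdef
  set h := gH e u p with hhdef
  have hhp : 0 < h := hH p hp
  set w := 1 / V with hw
  have hwp : 0 < w := by positivity
  set N := fun i => gN e u i p with hNdef
  have hNN : ∑ i, N i ^ 2 = 1 - w ^ 2 := by
    have h1 : ∑ i, dd (e i) u p ^ 2 = V ^ 2 * ∑ i, N i ^ 2 := by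
      rw [Finset.mul_sum]; refine Finset.sum_congr rfl fun i _ => ?_
      rw [← gVN]; ring
    have h2 := gV_sq e u p
    rw [h1] at h2
    rw [hw]; field_simp; linarith
  have hw1 : w ≤ 1 := by
    have : 0 ≤ ∑ i, N i ^ 2 := by positivity
    nlinarith
  have dF := sm_diff hΩ hF hp
  have du := sm_diff hΩ hu hp
  have dDu : ∀ f, DifferentiableAt ℝ (dd f u) p := fun f => sm_diff hΩ (dd_smooth hΩ hu f) hp
  have dDF : ∀ f, DifferentiableAt ℝ (dd f F) p := fun f => sm_diff hΩ (dd_smooth hΩ hF f) hp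
  have ddc : ∀ f q, q ∈ Ω → dd f (fun q => F q + c * u q) q = dd f F q + c * dd f u q := by
    intro f q hq
    rw [dd_add f (sm_diff hΩ hF hq) ((differentiableAt_const _).fun_mul (sm_diff hΩ hu hq)),
      dd_mul f (differentiableAt_const _) (sm_diff hΩ hu hq)]
    have : dd f (fun _ : E => c) q = 0 := by simp [dd]
    rw [this]; ring
  have ddc2 : ∀ f g, dd f (dd g (fun q => F q + c * u q)) p = dd f (dd g F) p + c * dd f (dd g u) p := by
    intro f g
    rw [dd_congr hΩ (ddc g) f hp, dd_add f (dDF g) ((differentiableAt_const _).fun_mul (dDu g)),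
      dd_mul f (differentiableAt_const _) (dDu g)]
    have : dd f (fun _ : E => c) p = 0 := by simp [dd]
    rw [this]; ring
  have hgrad : ∀ j, dd (e j) F p = - c * V * N j := by
    intro j
    have h1 := (second_test hΩ hG hp (∑ i, (Pi.single j (1:ℝ) : Fin n → ℝ) i • e i) (hmin _)).1
    have h2 : ∑ i, (Pi.single j (1:ℝ) : Fin n → ℝ) i • e i = e j := by
      simp [Pi.single_apply]
    rw [h2, ddc _ _ hp, ← gVN e u] at h1
    simp only [N, hVdef]; linarith
  have hquad := quad_nonneg N w hwp hNN
    (fun i j => dd (e i) (dd (e j) (fun q => F q + c * u q)) p) (by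
      intro ξ
      rw [← hess_lin hΩ hG hp ξ]
      exact (second_test hΩ hG hp _ (hmin ξ)).2)
  have hVH : V * h = ∑ i, dd (e i) (dd (e i) u) p
      - ∑ i, ∑ j, N i * N j * dd (e i) (dd (e j) u) p := by
    rw [hhdef, gH, Finset.mul_sum, ← Finset.sum_sub_distrib]
    refine Finset.sum_congr rfl fun i _ => ?_
    rw [dd_gN hΩ hu _ i hp, Finset.mul_sum]
    congr 1; refine Finset.sum_congr rfl fun j _ => by simp only [N]; ring
  simp only [ddc2] at hquad
  have hq2 : 0 ≤ (∑ i, dd (e i) (dd (e i) F) p - ∑ i, ∑ j, N i * N j * dd (e i) (dd (e j) F) p)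
      + c * (V * h) := by
    rw [hVH]
    simp only [mul_add, Finset.sum_add_distrib, mul_sub, Finset.mul_sum] at hquad ⊢
    have : ∀ i j, N i * N j * (c * dd (e i) (dd (e j) u) p)
        = c * (N i * N j * dd (e i) (dd (e j) u) p) := fun i j => by ring
    simp only [this] at hquad
    linarith
  have hA : 0 < ∑ i, ∑ k, dd (e i) (gN e u k) p * dd (e k) (gN e u i) p := by
    apply trace_sq_pos N w hwp hNN (fun i j => dd (e i) (dd (e j) u) p)
      (fun i k => dd (e i) (gN e u k) p) (fun i j => dd_comm hΩ hu _ _ hp)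
    · intro i k
      have := dd_gN (e := e) hΩ hu (e i) k hp
      simp only [N]
      rw [← this, hw]; field_simp; rw [hVdef]
    · exact hhp
  set A := ∑ i, ∑ k, dd (e i) (gN e u k) p * dd (e k) (gN e u i) p with hAdef
  have hchain : ∀ f, dd f F p = α * h ^ (α - 1) * dd f (gH e u) p := by
    intro f
    have h1 := ((sm_diff hΩ hHs hp).hasFDerivAt.rpow_const (p := α) (Or.inl hhp.ne')).fderiv
    simp only [dd, hFdef, h1]
    simp [hhdef]
  have hevo := dt_gH hΩ hu hF et hflow hp
  have hF0 : F p = c * ψ := hψ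
  have hsN : ∑ j, gN e u j p * dd (e j) F p = - c * V * (1 - w ^ 2) := by
    rw [← hNN, Finset.mul_sum]; refine Finset.sum_congr rfl fun j _ => ?_
    rw [hgrad]; simp only [N]; ring
  set S := ∑ k, gN e u k p * dd (e k) (gH e u) p with hS
  set κ := α * h ^ (α - 1) with hκ
  have hκp : 0 < κ := by positivity
  have hκS : κ * S = - c * V * (1 - w ^ 2) := by
    rw [← hsN, hS, Finset.mul_sum]; refine Finset.sum_congr rfl fun j _ => ?_
    rw [hchain]; ring
  have hκh : κ * h = α * F p := by
    rw [hκ, Real.rpow_sub_one hhp.ne', show F p = h ^ α from rfl]; field_simp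
  have hVw : V * w = 1 := by rw [hw]; field_simp
  rw [hsN] at hevo
  have hFp : 0 < F p := by rw [hF0]; positivity
  have hlow : -c * h * w + F p * A + F p * S ≤ dd et (gH e u) p := by
    rw [hevo]
    have : -c * h * w = - c * (V * h) - h * (- c * V * (1 - w ^ 2)) := by
      linear_combination (c * h * w) * hVw
    rw [this]
    linarith
  have hlow2 := mul_le_mul_of_nonneg_left hlow hκp.le
  rw [← hchain] at hlow2
  have hfl : dd et u p = V * F p := hflow p hp
  rw [hfl] at htime
  have hfin : κ * (F p * A) + c * (b + (1 - α) * F p * w) ≤ 0 := by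
    have e1 : κ * (-c * h * w + F p * A + F p * S)
        = - c * w * (κ * h) + κ * (F p * A) + F p * (κ * S) := by ring
    rw [e1, hκh, hκS] at hlow2
    have e2 : F p * (-c * V * (1 - w ^ 2)) = - c * V * F p + c * F p * w := by
      linear_combination (c * F p * w) * hVw
    rw [e2] at hlow2
    linarith
  have hpos : 0 < κ * (F p * A) := by positivity
  have hfac : 0 ≤ b + (1 - α) * F p * w := by
    rcases hcase with h1 | ⟨h1, h2⟩
    · have : 0 ≤ 1 - α := by linarith
      positivity
    · rw [lt_div_iff₀ (by have : 0 < α - 1 := by linarith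
                          positivity)] at h2
      rw [hF0]
      have h3 : 0 < α - 1 := by linarith
      have h4 : ψ * w ≤ a := (mul_le_of_le_one_right hψ0.le hw1).trans hψa
      have h5 : c * (α - 1) * (ψ * w) ≤ c * (α - 1) * a := by gcongr
      have h6 : (1 - α) * (c * ψ) * w = -(c * (α - 1) * (ψ * w)) := by ring
      have h7 : c * (a * (α - 1)) = c * (α - 1) * a := by ring
      linarith
  have : 0 ≤ c * (b + (1 - α) * F p * w) := by positivity
  linarith
end calcu


section linking
variable {n : ℕ}

def ev (n : ℕ) (i : Fin n) : En n × ℝ := (EuclideanSpace.single i 1, 0)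
def et (n : ℕ) : En n × ℝ := (0, 1)

lemma slice_hasFDeriv {U : Set (En n)} (hU : IsOpen U) {I : Set ℝ} {g : En n × ℝ → ℝ}
    {x : En n} {t : ℝ} (hx : x ∈ U) (ht : t ∈ I)
    (hg : DifferentiableWithinAt ℝ g (U ×ˢ I) (x, t)) :
    HasFDerivAt (fun y => g (y, t))
      ((fderivWithin ℝ g (U ×ˢ I) (x, t)).comp (ContinuousLinearMap.inl ℝ (En n) ℝ)) x := by
  have h1 : HasFDerivWithinAt (fun y : En n => (y, t)) (ContinuousLinearMap.inl ℝ (En n) ℝ) U x :=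
    (hasFDerivAt_prodMk_left x t).hasFDerivWithinAt
  have hmaps : MapsTo (fun y : En n => (y, t)) U (U ×ˢ I) := fun y hy => ⟨hy, ht⟩
  have h2 : HasFDerivWithinAt (fun y => g (y, t))
      ((fderivWithin ℝ g (U ×ˢ I) (x, t)).comp (ContinuousLinearMap.inl ℝ (En n) ℝ)) U x :=
    HasFDerivWithinAt.comp (g := g) x hg.hasFDerivWithinAt h1 hmaps
  exact h2.hasFDerivAt (hU.mem_nhds hx)

lemma slice_smooth {U : Set (En n)} (hU : IsOpen U) {T : ℝ} (hT : 0 < T) {g : En n × ℝ → ℝ}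
    (hg : ContDiffOn ℝ (⊤ : ℕ∞) g (U ×ˢ Icc 0 T)) (i : Fin n) :
    ContDiffOn ℝ (⊤ : ℕ∞) (fun q : En n × ℝ => pd (fun y => g (y, q.2)) i q.1) (U ×ˢ Icc 0 T) := by
  have hun : UniqueDiffOn ℝ (U ×ˢ Icc (0:ℝ) T) := hU.uniqueDiffOn.prod (uniqueDiffOn_Icc hT)
  have h1 : ContDiffOn ℝ (⊤ : ℕ∞) (fun q => fderivWithin ℝ g (U ×ˢ Icc 0 T) q (ev n i))
      (U ×ˢ Icc 0 T) :=
    (hg.fderivWithin hun (m := (⊤ : ℕ∞)) (by simp)).clm_apply contDiffOn_const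
  refine h1.congr ?_
  rintro ⟨x, t⟩ ⟨hx, ht⟩
  have := slice_hasFDeriv hU hx ht (hg.differentiableOn (by simp) (x, t) ⟨hx, ht⟩)
  simp only [pd]
  rw [this.fderiv]
  simp [ev]

/-- space-time versions -/
def HV (u : En n → ℝ → ℝ) (q : En n × ℝ) : ℝ := graphV (fun y => u y q.2) q.1
def HC (u : En n → ℝ → ℝ) (q : En n × ℝ) : ℝ := meanCurv (fun y => u y q.2) q.1
def HK (u : En n → ℝ → ℝ) (i : Fin n) (q : En n × ℝ) : ℝ := pd (fun y => u y q.2) i q.1 / HV u q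

lemma HC_smooth {U : Set (En n)} (hU : IsOpen U) {T : ℝ} (hT : 0 < T) {u : En n → ℝ → ℝ}
    (hu : ContDiffOn ℝ (⊤ : ℕ∞) (fun p : En n × ℝ => u p.1 p.2) (U ×ˢ Icc 0 T)) :
    ContDiffOn ℝ (⊤ : ℕ∞) (HC u) (U ×ˢ Icc 0 T) := by
  have h1 : ∀ i, ContDiffOn ℝ (⊤ : ℕ∞) (fun q : En n × ℝ => pd (fun y => u y q.2) i q.1)
      (U ×ˢ Icc 0 T) := fun i => slice_smooth hU hT hu i
  have h2 : ContDiffOn ℝ (⊤ : ℕ∞) (HV u) (U ×ˢ Icc 0 T) := by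
    unfold HV graphV gradNormSq
    apply ContDiffOn.sqrt
    · exact contDiffOn_const.add (ContDiffOn.sum fun i _ => (h1 i).pow 2)
    · intro p _; positivity
  have h3 : ∀ i, ContDiffOn ℝ (⊤ : ℕ∞) (HK u i) (U ×ˢ Icc 0 T) := by
    intro i
    unfold HK
    refine (h1 i).div h2 fun p _ => ?_
    unfold HV graphV gradNormSq
    exact (Real.sqrt_pos.2 (by positivity)).ne'
  unfold HC meanCurv
  exact ContDiffOn.sum fun i _ => slice_smooth hU hT (h3 i) i

lemma pd_eq_dd {g : En n × ℝ → ℝ} {x : En n} {t : ℝ} (hg : DifferentiableAt ℝ g (x, t)) (i : Fin n) :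
    pd (fun y => g (y, t)) i x = dd (ev n i) g (x, t) := by
  have h1 : HasFDerivAt (fun y : En n => (y, t)) (ContinuousLinearMap.inl ℝ (En n) ℝ) x :=
    hasFDerivAt_prodMk_left x t
  have h3 : HasFDerivAt (fun y => g (y, t))
      ((fderiv ℝ g (x, t)).comp (ContinuousLinearMap.inl ℝ (En n) ℝ)) x :=
    HasFDerivAt.comp (g := g) x hg.hasFDerivAt h1
  simp only [pd, dd]
  rw [h3.fderiv]
  simp [ev]

lemma HV_eq {Ω : Set (En n × ℝ)} (hΩ : IsOpen Ω) {u : En n → ℝ → ℝ}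
    (hu : ContDiffOn ℝ (⊤ : ℕ∞) (fun p : En n × ℝ => u p.1 p.2) Ω) {q : En n × ℝ} (hq : q ∈ Ω) :
    HV u q = gV (ev n) (fun p : En n × ℝ => u p.1 p.2) q := by
  have h : ∀ i, pd (fun y => u y q.2) i q.1 = dd (ev n i) (fun p : En n × ℝ => u p.1 p.2) q :=
    fun i => pd_eq_dd (g := fun p : En n × ℝ => u p.1 p.2) (sm_diff hΩ hu hq) i
  simp only [HV, graphV, gradNormSq, gV, h]

lemma HC_eq {Ω : Set (En n × ℝ)} (hΩ : IsOpen Ω) {u : En n → ℝ → ℝ}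
    (hu : ContDiffOn ℝ (⊤ : ℕ∞) (fun p : En n × ℝ => u p.1 p.2) Ω) {q : En n × ℝ} (hq : q ∈ Ω) :
    HC u q = gH (ev n) (fun p : En n × ℝ => u p.1 p.2) q := by
  have hK : ∀ i, ∀ p ∈ Ω, HK u i p = gN (ev n) (fun p : En n × ℝ => u p.1 p.2) i p := by
    intro i p hp
    have h : pd (fun y => u y p.2) i p.1 = dd (ev n i) (fun p : En n × ℝ => u p.1 p.2) p :=
      pd_eq_dd (g := fun p : En n × ℝ => u p.1 p.2) (sm_diff hΩ hu hp) i
    simp only [HK, gN, HV_eq hΩ hu hp, h]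
  have hKs : ∀ i, ContDiffOn ℝ (⊤ : ℕ∞) (HK u i) Ω := fun i =>
    (gN_smooth hΩ hu i).congr (hK i)
  unfold HC meanCurv gH
  refine Finset.sum_congr rfl fun i _ => ?_
  rw [← dd_congr hΩ (hK i) _ hq]
  exact pd_eq_dd (g := HK u i) (sm_diff hΩ (hKs i) hq) i

lemma left_deriv_nonpos {φ : ℝ → ℝ} {d r : ℝ} (h : HasDerivAt φ d r)
    (hm : ∀ᶠ s in nhdsWithin r (Iio r), φ r ≤ φ s) : d ≤ 0 := by
  have h1 := (hasDerivWithinAt_iff_tendsto_slope' (s := Iio r) (by simp)).1 h.hasDerivWithinAt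
  refine le_of_tendsto h1 ?_
  filter_upwards [hm, self_mem_nhdsWithin] with s hs hs2
  rw [slope_def_field]
  exact div_nonpos_of_nonneg_of_nonpos (by linarith) (by simp only [mem_Iio] at hs2; linarith)

lemma dt_line {g : En n × ℝ → ℝ} {x : En n} {t : ℝ} (hg : DifferentiableAt ℝ g (x, t)) :
    HasDerivAt (fun s => g (x, s)) (dd (et n) g (x, t)) t := by
  have h1 : HasDerivAt (fun s : ℝ => (x, s)) (et n) t :=
    (hasDerivAt_const t x).prodMk (hasDerivAt_id t)
  exact hg.hasFDerivAt.comp_hasDerivAt t h1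

lemma graphV_pos (f : En n → ℝ) (x : En n) : 0 < graphV f x := by
  unfold graphV gradNormSq
  exact Real.sqrt_pos.2 (by positivity)

lemma mono_time (α a T : ℝ)
    (U : Set (En n)) (u : En n → ℝ → ℝ)
    (hsm : ContinuousOn (fun p : En n × ℝ => u p.1 p.2) (U ×ˢ Set.Icc 0 T))
    (hflow : ∀ x ∈ U, ∀ t ∈ Set.Icc (0:ℝ) T, u x t < a + 1 →
      0 < meanCurv (fun y => u y t) x ∧
      deriv (u x) t = graphV (fun y => u y t) x * meanCurv (fun y => u y t) x ^ α)
    {x : En n} (hx : x ∈ U) {t : ℝ} (ht : t ∈ Icc 0 T) (hua : u x t ≤ a) : u x 0 ≤ u x t := by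
  have hcont : ContinuousOn (u x) (Icc 0 t) := by
    have : ContinuousOn (fun s : ℝ => (x, s)) (Icc 0 t) := by fun_prop
    exact hsm.comp this (fun s hs => ⟨hx, hs.1, hs.2.trans ht.2⟩)
  obtain ⟨r, hr, hmin⟩ := isCompact_Icc.exists_isMinOn ⟨t, right_mem_Icc.2 ht.1⟩ hcont
  have hle : u x r ≤ u x t := hmin (right_mem_Icc.2 ht.1)
  rcases hr.1.eq_or_lt with h | h
  · rw [h]; exact hle
  · exfalso
    obtain ⟨h1, h2⟩ := hflow x hx r ⟨hr.1, hr.2.trans ht.2⟩ (by linarith)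
    have hpos : 0 < deriv (u x) r := by
      rw [h2]; exact mul_pos (graphV_pos _ _) (Real.rpow_pos_of_pos h1 _)
    have hd : DifferentiableAt ℝ (u x) r := differentiableAt_of_deriv_ne_zero hpos.ne'
    have := left_deriv_nonpos hd.hasDerivAt (by
      filter_upwards [Ioo_mem_nhdsLT h] with s hs
      exact hmin ⟨hs.1.le, hs.2.le.trans hr.2⟩)
    linarith

lemma core (α a b T : ℝ)
    (hα : 0 < α) (ha : 0 < a) (hb : 0 ≤ b) (hT : 0 < T)
    (U : Set (En n)) (hU : IsOpen U) (u : En n → ℝ → ℝ)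
    (hsm : ContDiffOn ℝ (⊤ : ℕ∞) (fun p : En n × ℝ => u p.1 p.2) (U ×ˢ Set.Icc 0 T))
    (hnn : ∀ x ∈ U, ∀ t ∈ Set.Icc (0:ℝ) T, 0 ≤ u x t)
    (hcpt : ∀ t ∈ Set.Icc (0:ℝ) T, IsCompact {x ∈ U | u x t ≤ a})
    (hflow : ∀ x ∈ U, ∀ t ∈ Set.Icc (0:ℝ) T, u x t < a + 1 →
      0 < meanCurv (fun y => u y t) x ∧
      deriv (u x) t = graphV (fun y => u y t) x * meanCurv (fun y => u y t) x ^ α)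
    (m : ℝ) (hm : ∀ y ∈ U, 0 < a - u y 0 → m ≤ HC u (y, 0) ^ α / (a - u y 0))
    (hcase : α ≤ 1 ∨ (1 < α ∧ m ≤ b / (a * (α - 1))))
    {x₁ : En n} (hx₁ : x₁ ∈ U) {t₁ : ℝ} (ht₁ : t₁ ∈ Ico 0 T) (hψ₁ : 0 < a - b * t₁ - u x₁ t₁) :
    m ≤ HC u (x₁, t₁) ^ α / (a - b * t₁ - u x₁ t₁) := by
  by_contra hcon
  push Not at hcon
  set uu : En n × ℝ → ℝ := fun p => u p.1 p.2 with huu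
  set ψ : En n × ℝ → ℝ := fun p => a - b * p.2 - u p.1 p.2 with hψdef
  have hψc : ContinuousOn ψ (U ×ˢ Icc 0 T) := by
    have h1 : ContinuousOn (fun p : En n × ℝ => a - b * p.2) (U ×ˢ Icc 0 T) := by fun_prop
    exact h1.sub hsm.continuousOn
  set K0 : Set (En n) := {x ∈ U | u x 0 ≤ a} with hK0
  have hK0c : IsCompact K0 := hcpt 0 ⟨le_rfl, hT.le⟩
  set B := K0 ×ˢ Icc 0 t₁ with hB
  have hBc : IsCompact B := hK0c.prod isCompact_Icc
  have hBD : B ⊆ U ×ˢ Icc 0 T := fun q hq => ⟨hq.1.1, hq.2.1, hq.2.2.trans ht₁.2.le⟩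
  set K := B ∩ ψ ⁻¹' (Ici 0) with hK
  have hKc : IsCompact K :=
    hBc.of_isClosed_subset ((hψc.mono hBD).preimage_isClosed_of_isClosed hBc.isClosed isClosed_Ici)
      inter_subset_left
  have hbt : ∀ q ∈ U ×ˢ Icc 0 T, 0 ≤ ψ q → u q.1 q.2 ≤ a := by
    intro q hq h
    have : 0 ≤ b * q.2 := mul_nonneg hb hq.2.1
    simp only [hψdef] at h; linarith
  have hHpos : ∀ q ∈ U ×ˢ Icc 0 T, 0 ≤ ψ q → 0 < HC u q := by
    intro q hq h
    exact (hflow q.1 hq.1 q.2 hq.2 (by linarith [hbt q hq h])).1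
  have hinK : ∀ q ∈ U ×ˢ Icc 0 T, q.2 ≤ t₁ → 0 ≤ ψ q → q ∈ K := by
    intro q hq h1 h2
    have h3 := hbt q hq h2
    have h4 := mono_time α a T U u hsm.continuousOn hflow hq.1 hq.2 h3
    exact ⟨⟨⟨hq.1, h4.trans h3⟩, hq.2.1, h1⟩, h2⟩
  have hFc : ContinuousOn (fun q => ψ q / HC u q ^ α) K := by
    have hKD : K ⊆ U ×ˢ Icc 0 T := inter_subset_left.trans hBD
    refine (hψc.mono hKD).div ?_ ?_
    · exact ((HC_smooth hU hT hsm).continuousOn.mono hKD).rpow_const fun q hq =>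
        Or.inl (hHpos q (hKD hq) hq.2).ne'
    · intro q hq; exact (Real.rpow_pos_of_pos (hHpos q (hKD hq) hq.2) _).ne'
  have hq₁K : ((x₁, t₁) : En n × ℝ) ∈ K := hinK _ ⟨hx₁, ht₁.1, ht₁.2.le⟩ le_rfl hψ₁.le
  obtain ⟨q₀, hq₀, hmax⟩ := hKc.exists_isMaxOn ⟨_, hq₁K⟩ hFc
  have hKD : K ⊆ U ×ˢ Icc 0 T := inter_subset_left.trans hBD
  have hFpos : ∀ q ∈ K, 0 < HC u q ^ α := fun q hq =>
    Real.rpow_pos_of_pos (hHpos q (hKD hq) hq.2) _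
  have hP1 : 0 < ψ (x₁, t₁) / HC u (x₁, t₁) ^ α := div_pos hψ₁ (hFpos _ hq₁K)
  have hle1 : ψ (x₁, t₁) / HC u (x₁, t₁) ^ α ≤ ψ q₀ / HC u q₀ ^ α := hmax hq₁K
  have hP0 : 0 < ψ q₀ / HC u q₀ ^ α := hP1.trans_le hle1
  have hψ0 : 0 < ψ q₀ := by
    by_contra h; push Not at h
    exact absurd (div_nonpos_of_nonpos_of_nonneg h (hFpos _ hq₀).le) (not_le.2 hP0)
  set c := HC u q₀ ^ α / ψ q₀ with hc
  have hcp : 0 < c := div_pos (hFpos _ hq₀) hψ0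
  have hceq : HC u q₀ ^ α = c * ψ q₀ := by rw [hc]; field_simp
  have hcm : c < m := by
    refine lt_of_le_of_lt ?_ hcon
    have := inv_anti₀ hP1 hle1
    rwa [inv_div, inv_div] at this
  have hKineq : ∀ q ∈ K, c * ψ q ≤ HC u q ^ α := by
    intro q hq
    have h1 : ψ q / HC u q ^ α ≤ ψ q₀ / HC u q₀ ^ α := hmax hq
    rw [div_le_div_iff₀ (hFpos q hq) (hFpos _ hq₀), hceq] at h1
    have : ψ q₀ * (c * ψ q) ≤ ψ q₀ * HC u q ^ α := by linarith
    exact le_of_mul_le_mul_left this hψ0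
  obtain ⟨x₀, t₀⟩ := q₀
  have ht0pos : 0 < t₀ := by
    rcases hq₀.1.2.1.eq_or_lt with h | h
    · exfalso
      have h0 : t₀ = 0 := h.symm
      subst h0
      have e1 : ψ (x₀, 0) = a - u x₀ 0 := by simp [hψdef]
      have := hm x₀ (hKD hq₀).1 (by rw [← e1]; exact hψ0)
      rw [← e1] at this
      linarith
    · exact h
  have ht0T : t₀ < T := lt_of_le_of_lt hq₀.1.2.2 ht₁.2
  -- the open region
  have hW : IsOpen (U ×ˢ Ioo 0 T) := hU.prod isOpen_Ioo
  have hWD : U ×ˢ Ioo 0 T ⊆ U ×ˢ Icc 0 T := prod_mono le_rfl Ioo_subset_Icc_self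
  have hsW := hsm.mono hWD
  set Ω := (U ×ˢ Ioo 0 T) ∩ ψ ⁻¹' (Ioi 0) with hΩdef
  have hΩ : IsOpen Ω := (hψc.mono hWD).isOpen_inter_preimage hW isOpen_Ioi
  have hΩW : Ω ⊆ U ×ˢ Ioo 0 T := inter_subset_left
  have hsΩ : ContDiffOn ℝ (⊤ : ℕ∞) uu Ω := hsW.mono hΩW
  have hp : ((x₀, t₀) : En n × ℝ) ∈ Ω := ⟨⟨(hKD hq₀).1, ht0pos, ht0T⟩, hψ0⟩
  have hgeq : ∀ q ∈ Ω, HC u q = gH (ev n) uu q := fun q hq => HC_eq hΩ hsΩ hq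
  have hΩK : ∀ q ∈ Ω, q.2 ≤ t₁ → c * ψ q ≤ gH (ev n) uu q ^ α := by
    intro q hq h
    rw [← hgeq q hq]
    exact hKineq q (hinK q (hWD hq.1) h hq.2.le)
  have hH' : ∀ q ∈ Ω, 0 < gH (ev n) uu q := fun q hq => by
    rw [← hgeq q hq]; exact hHpos q (hWD hq.1) hq.2.le
  have hflow' : ∀ q ∈ Ω, dd (et n) uu q = gV (ev n) uu q * gH (ev n) uu q ^ α := by
    rintro ⟨x, t⟩ hq
    rw [← hgeq _ hq, ← HV_eq hΩ hsΩ hq]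
    have h1 := (dt_line (sm_diff hΩ hsΩ hq)).deriv
    rw [← h1]
    exact (hflow x hq.1.1 t (hWD hq.1).2 (by linarith [hbt _ (hWD hq.1) hq.2.le])).2
  have hceq' : gH (ev n) uu (x₀, t₀) ^ α = c * ψ (x₀, t₀) := by rw [← hgeq _ hp]; exact hceq
  have ht01 : t₀ ≤ t₁ := hq₀.1.2.2
  refine touch_false hΩ hsΩ (et n) α a b c (ψ (x₀, t₀)) hα ha hb hcp hH' hflow' hp ?_ ?_ hceq' hψ0 ?_ ?_
  · intro ξ
    have hcs : Continuous (fun s : ℝ => ((x₀, t₀) : En n × ℝ) + s • ∑ i, ξ i • ev n i) := by fun_prop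
    have hmem : ∀ᶠ s in nhds (0:ℝ), ((x₀, t₀) : En n × ℝ) + s • ∑ i, ξ i • ev n i ∈ Ω :=
      hcs.continuousAt.eventually_mem (by simpa using hΩ.mem_nhds hp)
    have h2 : (∑ i, ξ i • ev n i).2 = 0 := by simp [ev, Prod.snd_sum]
    filter_upwards [hmem] with s hs
    set q := ((x₀, t₀) : En n × ℝ) + s • ∑ i, ξ i • ev n i with hq
    have hq2 : q.2 = t₀ := by simp [hq, h2]
    have h3 := hΩK q hs (by rw [hq2]; exact ht01)
    have e1 : ψ q = a - b * t₀ - uu q := by simp only [hψdef, hq2, huu]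
    have e2 : ψ (x₀, t₀) = a - b * t₀ - uu (x₀, t₀) := rfl
    rw [e1] at h3
    rw [hceq', e2]
    linarith
  · have hFs : ContDiffOn ℝ (⊤ : ℕ∞) (fun q => gH (ev n) uu q ^ α) Ω :=
      (gH_smooth hΩ hsΩ).rpow_const_of_ne fun q hq => (hH' q hq).ne'
    have d1 := dt_line (sm_diff hΩ hFs hp)
    have d2 := dt_line (sm_diff hΩ hsΩ hp)
    have d3 : HasDerivAt (fun s : ℝ => a - b * s) (-b) t₀ := by
      simpa using ((hasDerivAt_id t₀).const_mul b).const_sub a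
    have d4 := d1.sub ((d3.sub d2).const_mul c)
    have := left_deriv_nonpos d4 (by
      have hcs : Continuous (fun s : ℝ => ((x₀, s) : En n × ℝ)) := by fun_prop
      have hmem : ∀ᶠ s in nhds t₀, ((x₀, s) : En n × ℝ) ∈ Ω :=
        hcs.continuousAt.eventually_mem (hΩ.mem_nhds hp)
      filter_upwards [mem_nhdsWithin_of_mem_nhds hmem, self_mem_nhdsWithin] with s hs hs2
      have h3 := hΩK (x₀, s) hs (le_of_lt (lt_of_lt_of_le hs2 ht01))
      have e0 : c * (a - b * t₀ - uu (x₀, t₀)) = gH (ev n) uu (x₀, t₀) ^ α := hceq'.symm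
      have e1 : c * (a - b * s - uu (x₀, s)) ≤ gH (ev n) uu (x₀, s) ^ α := h3
      simp only [Pi.sub_apply]
      linarith)
    linarith
  · have h1 := hnn x₀ (hKD hq₀).1 t₀ (hKD hq₀).2
    have h2 : 0 ≤ b * t₀ := mul_nonneg hb ht0pos.le
    simp only [hψdef]; linarith
  · rcases hcase with h | ⟨h, h'⟩
    · exact Or.inl h
    · exact Or.inr ⟨h, hcm.trans_le h'⟩

lemma core' (α a b T : ℝ)
    (hα : 0 < α) (ha : 0 < a) (hb : 0 ≤ b) (hT : 0 < T)
    (U : Set (En n)) (hU : IsOpen U) (u : En n → ℝ → ℝ)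
    (hsm : ContDiffOn ℝ (⊤ : ℕ∞) (fun p : En n × ℝ => u p.1 p.2) (U ×ˢ Set.Icc 0 T))
    (hnn : ∀ x ∈ U, ∀ t ∈ Set.Icc (0:ℝ) T, 0 ≤ u x t)
    (hcpt : ∀ t ∈ Set.Icc (0:ℝ) T, IsCompact {x ∈ U | u x t ≤ a})
    (hflow : ∀ x ∈ U, ∀ t ∈ Set.Icc (0:ℝ) T, u x t < a + 1 →
      0 < meanCurv (fun y => u y t) x ∧
      deriv (u x) t = graphV (fun y => u y t) x * meanCurv (fun y => u y t) x ^ α)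
    (m : ℝ) (hm : ∀ y ∈ U, 0 < a - u y 0 → m ≤ HC u (y, 0) ^ α / (a - u y 0))
    (hcase : α ≤ 1 ∨ (1 < α ∧ m ≤ b / (a * (α - 1))))
    {x : En n} (hx : x ∈ U) {t : ℝ} (ht : t ∈ Icc 0 T) (hψ : 0 < a - b * t - u x t) :
    m ≤ HC u (x, t) ^ α / (a - b * t - u x t) := by
  have hc0 := @core n α a b T hα ha hb hT U hU u hsm hnn hcpt hflow m hm hcase x hx
  rcases ht.2.lt_or_eq with h | h
  · exact hc0 ⟨ht.1, h⟩ hψ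
  · subst h
    have hin : ContinuousOn (fun s : ℝ => (x, s)) (Icc 0 t) := by fun_prop
    have hmaps : MapsTo (fun s : ℝ => (x, s)) (Icc 0 t) (U ×ˢ Icc 0 t) := fun s hs => ⟨hx, hs⟩
    have c1 : ContinuousOn (fun s => u x s) (Icc 0 t) := hsm.continuousOn.comp hin hmaps
    have c2 : ContinuousOn (fun s => HC u (x, s)) (Icc 0 t) :=
      (HC_smooth hU hT hsm).continuousOn.comp hin hmaps
    have c3 : ContinuousOn (fun s => a - b * s - u x s) (Icc 0 t) := by
      have : ContinuousOn (fun s : ℝ => a - b * s) (Icc 0 t) := by fun_prop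
      exact this.sub c1
    have hHp : 0 < HC u (x, t) := (hflow x hx t ht (by
      have : 0 ≤ b * t := mul_nonneg hb ht.1
      linarith)).1
    have c4 : ContinuousWithinAt (fun s => HC u (x, s) ^ α / (a - b * s - u x s)) (Icc 0 t) t :=
      ((c2 t ht).rpow_const (Or.inl hHp.ne')).div (c3 t ht) hψ.ne'
    have hne : (nhdsWithin t (Ico 0 t)).NeBot := by
      rw [← mem_closure_iff_nhdsWithin_neBot, closure_Ico hT.ne]; exact ht
    have hle : nhdsWithin t (Ico 0 t) ≤ nhdsWithin t (Icc 0 t) := nhdsWithin_mono _ Ico_subset_Icc_self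
    refine ge_of_tendsto (c4.tendsto.mono_left hle) ?_
    have hev : ∀ᶠ s in nhdsWithin t (Ico 0 t), 0 < a - b * s - u x s :=
      ((c3 t ht).tendsto.mono_left hle).eventually (lt_mem_nhds hψ)
    filter_upwards [hev, self_mem_nhdsWithin] with s hs hs2
    exact hc0 hs2 hs

end linking

/-- Localized lower bound on the mean curvature for the graphical
`H^α`-flow. -/
theorem localized_lower_H_bound (n : ℕ) (hn : 1 ≤ n) (α a b T : ℝ)
    (hα : 0 < α) (ha : 0 < a) (hb : 0 ≤ b) (hT : 0 < T)
    (U : Set (En n)) (hU : IsOpen U) (u : En n → ℝ → ℝ)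
    (hsm : ContDiffOn ℝ (⊤ : ℕ∞) (fun p : En n × ℝ => u p.1 p.2) (U ×ˢ Set.Icc 0 T))
    (hnn : ∀ x ∈ U, ∀ t ∈ Set.Icc (0:ℝ) T, 0 ≤ u x t)
    (hcpt : ∀ t ∈ Set.Icc (0:ℝ) T, IsCompact {x ∈ U | u x t ≤ a})
    (hflow : ∀ x ∈ U, ∀ t ∈ Set.Icc (0:ℝ) T, u x t < a + 1 →
      0 < meanCurv (fun y => u y t) x ∧
      deriv (u x) t = graphV (fun y => u y t) x * meanCurv (fun y => u y t) x ^ α) :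
    ∀ x ∈ U, ∀ t ∈ Set.Icc (0:ℝ) T, 0 < psiF a b u x t →
      (α ≤ 1 →
        sInf ((fun y => meanCurv (fun z => u z 0) y ^ α / psiF a b u y 0) ''
            {y ∈ U | 0 < psiF a b u y 0}) ≤
          meanCurv (fun y => u y t) x ^ α / psiF a b u x t) ∧
      (1 < α →
        min (sInf ((fun y => meanCurv (fun z => u z 0) y ^ α / psiF a b u y 0) ''
              {y ∈ U | 0 < psiF a b u y 0}))
            (b / (a * (α - 1))) ≤
          meanCurv (fun y => u y t) x ^ α / psiF a b u x t) := by
  intro x hx t ht hψ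
  have hψ' : 0 < a - b * t - u x t := by
    unfold psiF at hψ
    rcases lt_max_iff.1 hψ with h | h
    · exact h
    · exact absurd h (lt_irrefl _)
  have hpe : psiF a b u x t = a - b * t - u x t := max_eq_left hψ'.le
  have hp0 : ∀ y, 0 < a - u y 0 → psiF a b u y 0 = a - u y 0 := by
    intro y hy
    simp only [psiF, mul_zero, sub_zero]
    exact max_eq_left hy.le
  set S := (fun y => meanCurv (fun z => u z 0) y ^ α / psiF a b u y 0) ''
            {y ∈ U | 0 < psiF a b u y 0} with hS
  have hbdd : BddBelow S := by
    refine ⟨0, ?_⟩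
    rintro _ ⟨y, ⟨hy, hy2⟩, rfl⟩
    have h1 : u y 0 < a + 1 := by
      simp only [psiF, mul_zero, sub_zero] at hy2
      rcases lt_max_iff.1 hy2 with h | h
      · linarith
      · exact absurd h (lt_irrefl _)
    have h2 := (hflow y hy 0 ⟨le_rfl, hT.le⟩ h1).1
    exact div_nonneg (Real.rpow_nonneg h2.le _) hy2.le
  have hinf : ∀ y ∈ U, 0 < a - u y 0 → sInf S ≤ HC u (y, 0) ^ α / (a - u y 0) := by
    intro y hy h
    refine csInf_le hbdd ⟨y, ⟨hy, ?_⟩, ?_⟩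
    · rw [hp0 y h]; exact h
    · simp only [hp0 y h]; rfl
  rw [hpe]
  refine ⟨fun h => ?_, fun h => ?_⟩
  · exact core' α a b T hα ha hb hT U hU u hsm hnn hcpt hflow _ hinf (Or.inl h) hx ht hψ'
  · exact core' α a b T hα ha hb hT U hU u hsm hnn hcpt hflow _
      (fun y hy hy2 => (min_le_left _ _).trans (hinf y hy hy2)) (Or.inr ⟨h, min_le_right _ _⟩) hx ht hψ'
end
end

section
/- Let w̲ ∈ (0, 1/2]. There exists a constant C > 0, depending only on n, α, a and w̲, such that the following holds. Under the standing assumptions with b = 0, if w(x,t) ≥ 2·w̲ at every (x,t) with ψ(x,t) > 0, then at every (x,t) ∈ U × [0,T] with ψ(x,t) > 0 one has ψ(x,t)·H[u(·,t)](x) ≤ C · max{ sup{ ψ(y,0)·H[u(·,0)](y) : y ∈ U, ψ(y,0) > 0 }, 1 }. -/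
noncomputable section
open Set

open Set

lemma sum_pp {n : ℕ} (p q r s: Fin n → ℝ) :
    ∑ i, ∑ j, (p i * q j) * (r i * s j) = (∑ i, p i * r i) * (∑ j, q j * s j) := by
  rw [Finset.sum_mul_sum]
  exact Finset.sum_congr rfl fun i _ => Finset.sum_congr rfl fun j _ => by ring

/-- the symmetrised second fundamental form identity -/
lemma alg_S {n : ℕ} (p : Fin n → ℝ) (U : Fin n → Fin n → ℝ) (y : Fin n → ℝ)
    (hU : ∀ i j, U i j = U j i) (hy : ∀ i, ∑ k, p k * U k i = y i)
    (P v N Y z N1 : ℝ) (hP : P = ∑ i, p i * p i) (hv : 0 < v) (hv2 : v ^ 2 = 1 + P)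
    (hN : N = ∑ i, ∑ j, U i j * U i j) (hY : Y = ∑ i, y i * y i) (hz : z = ∑ i, p i * y i)
    (hN1 : N1 = ∑ i, U i i) :
    0 ≤ N - 2 * Y / v ^ 2 + z ^ 2 / v ^ 4 ∧
    (N1 - z / v ^ 2) ^ 2 ≤ n * (N - 2 * Y / v ^ 2 + z ^ 2 / v ^ 4) ∧
    z ^ 2 ≤ (v ^ 2 * P) ^ 2 * (N - 2 * Y / v ^ 2 + z ^ 2 / v ^ 4) := by
  set c : ℝ := 1 / (v * (v + 1)) with hc
  have hPv : P = v ^ 2 - 1 := by linarith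
  have hcP : c * P = 1 - 1 / v := by
    rw [hPv, hc]; field_simp; ring
  have hk : 2 * c - c ^ 2 * P = 1 / v ^ 2 := by
    rw [hPv, hc]; field_simp; ring
  set S : Fin n → Fin n → ℝ :=
    fun i j => U i j - c * (p i * y j) - c * (y i * p j) + c ^ 2 * z * (p i * p j) with hS
  have hy' : ∀ i, ∑ k, p k * U i k = y i := fun i => by
    rw [← hy i]; exact Finset.sum_congr rfl fun k _ => by rw [hU]
  have e1 : ∀ q : Fin n → ℝ, ∑ i, ∑ j, U i j * (p i * q j) = ∑ j, y j * q j := fun q => by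
    rw [Finset.sum_comm]
    refine Finset.sum_congr rfl fun j _ => ?_
    rw [← hy j, Finset.sum_mul]
    exact Finset.sum_congr rfl fun i _ => by ring
  have e2 : ∀ q : Fin n → ℝ, ∑ i, ∑ j, U i j * (q i * p j) = ∑ j, y j * q j := fun q => by
    refine Finset.sum_congr rfl fun j _ => ?_
    rw [← hy' j, Finset.sum_mul]
    exact Finset.sum_congr rfl fun i _ => by ring
  have hz' : ∑ i, y i * p i = z := by
    rw [hz]; exact Finset.sum_congr rfl fun i _ => by ring
  have hSS : ∑ i, ∑ j, S i j ^ 2 = N - 2 * Y / v ^ 2 + z ^ 2 / v ^ 4 := by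
    have h1 : ∀ i j, S i j ^ 2 = U i j * U i j + (-2 * c) * (U i j * (p i * y j))
        + (-2 * c) * (U i j * (y i * p j)) + (2 * c ^ 2 * z) * (U i j * (p i * p j))
        + c ^ 2 * ((p i * y j) * (p i * y j)) + c ^ 2 * ((y i * p j) * (y i * p j))
        + 2 * c ^ 2 * ((p i * y j) * (y i * p j))
        + (- 2 * c ^ 3 * z) * ((p i * y j) * (p i * p j))
        + (- 2 * c ^ 3 * z) * ((y i * p j) * (p i * p j))
        + (c ^ 4 * z ^ 2) * ((p i * p j) * (p i * p j)) := fun i j => by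
      simp only [hS]; ring
    simp only [h1, Finset.sum_add_distrib, ← Finset.mul_sum]
    rw [e1, e2, e2, sum_pp, sum_pp, sum_pp, sum_pp, sum_pp, sum_pp, hz', ← hz, ← hY, ← hP, ← hN]
    have : z ^ 2 / v ^ 4 = z ^ 2 * (1 / v ^ 2) ^ 2 := by field_simp
    rw [this, mul_div_assoc, show Y / v ^ 2 = Y * (1 / v ^ 2) by ring, ← hk]
    ring
  have htr : ∑ i, S i i = N1 - z / v ^ 2 := by
    have h1 : ∀ i, S i i = U i i + (-2 * c) * (p i * y i) + c ^ 2 * z * (p i * p i) := fun i => by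
      simp only [hS]; ring
    simp only [h1, Finset.sum_add_distrib, ← Finset.mul_sum]
    rw [← hz, ← hP, ← hN1, show z / v ^ 2 = z * (1 / v ^ 2) by ring, ← hk]
    ring
  have hpSp : ∑ i, ∑ j, S i j * (p i * p j) = z / v ^ 2 := by
    have h1 : ∀ i j, S i j * (p i * p j) = U i j * (p i * p j) + (-c) * ((p i * y j) * (p i * p j))
        + (-c) * ((y i * p j) * (p i * p j)) + c ^ 2 * z * ((p i * p j) * (p i * p j)) :=
      fun i j => by simp only [hS]; ring
    simp only [h1, Finset.sum_add_distrib, ← Finset.mul_sum]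
    rw [e1, sum_pp, sum_pp, sum_pp, hz', ← hP]
    have : z / v ^ 2 = z * (1 / v) ^ 2 := by field_simp
    rw [this, show 1 / v = 1 - c * P by linarith]
    ring
  rw [← hSS]
  have hdiag : ∑ i, S i i ^ 2 ≤ ∑ i, ∑ j, S i j ^ 2 := by
    refine Finset.sum_le_sum fun i _ => ?_
    exact Finset.single_le_sum (f := fun j => S i j ^ 2) (fun j _ => sq_nonneg _)
      (Finset.mem_univ i)
  refine ⟨Finset.sum_nonneg fun i _ => Finset.sum_nonneg fun j _ => sq_nonneg _, ?_, ?_⟩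
  · rw [← htr]
    have := sq_sum_le_card_mul_sum_sq (s := (Finset.univ : Finset (Fin n))) (f := fun i => S i i)
    simp only [Finset.card_univ, Fintype.card_fin] at this
    exact this.trans (by gcongr)
  · have h := Finset.sum_mul_sq_le_sq_mul_sq (Finset.univ : Finset (Fin n × Fin n))
      (fun q => S q.1 q.2) (fun q => p q.1 * p q.2)
    rw [Fintype.sum_prod_type, Fintype.sum_prod_type, Fintype.sum_prod_type] at h
    simp only [hpSp] at h
    have h2 : ∑ i, ∑ j, (p i * p j) ^ 2 = P ^ 2 := by
      simp only [pow_two]; rw [sum_pp, ← hP]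
    rw [h2] at h
    have h3 : z ^ 2 = v ^ 4 * (z / v ^ 2) ^ 2 := by field_simp
    rw [h3]
    nlinarith [mul_le_mul_of_nonneg_left h (show 0 ≤ v ^ 4 by positivity)]

/-- trace inequality from negative semidefiniteness -/
lemma alg_trace {n : ℕ} (p : Fin n → ℝ) (M : Fin n → Fin n → ℝ) (P v : ℝ)
    (hP : P = ∑ i, p i * p i) (hv : 0 < v) (hv2 : v ^ 2 = 1 + P)
    (hM : ∀ e : Fin n → ℝ, ∑ i, ∑ j, e i * e j * M i j ≤ 0) :
    ∑ i, M i i - (∑ i, ∑ j, p i * p j * M i j) / v ^ 2 ≤ 0 := by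
  set c : ℝ := 1 / (v * (v + 1)) with hc
  have hPv : P = v ^ 2 - 1 := by linarith
  have hk : 2 * c - c ^ 2 * P = 1 / v ^ 2 := by
    rw [hPv, hc]; field_simp; ring
  set q := ∑ i, ∑ j, p i * p j * M i j with hq
  have key : ∀ k, M k k - c * p k * (∑ j, p j * M k j) - c * p k * (∑ i, p i * M i k)
      + c ^ 2 * (p k * p k) * q ≤ 0 := fun k => by
    have h := hM (fun i => (if i = k then 1 else 0) - c * p k * p i)
    have h1 : ∀ i j, ((if i = k then (1:ℝ) else 0) - c * p k * p i)
        * ((if j = k then 1 else 0) - c * p k * p j) * M i j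
        = (if i = k then (1:ℝ) else 0) * ((if j = k then (1:ℝ) else 0) * M i j)
          - (if i = k then (1:ℝ) else 0) * (c * p k * (p j * M i j))
          - (if j = k then (1:ℝ) else 0) * (c * p k * (p i * M i j))
          + c ^ 2 * (p k * p k) * (p i * p j * M i j) := fun i j => by ring
    simp only [h1, Finset.sum_add_distrib, Finset.sum_sub_distrib, ← Finset.mul_sum] at h
    simp only [ite_mul, one_mul, zero_mul, Finset.sum_ite_eq', Finset.mem_univ, if_true] at h
    rw [← Finset.mul_sum] at h
    exact h
  have hs := Finset.sum_nonpos (s := Finset.univ) fun k _ => key k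
  simp only [Finset.sum_add_distrib, Finset.sum_sub_distrib] at hs
  have s1 : ∑ k, c * p k * (∑ j, p j * M k j) = c * q := by
    rw [hq, Finset.mul_sum]
    refine Finset.sum_congr rfl fun k _ => ?_
    rw [mul_assoc, Finset.mul_sum]
    congr 1
    exact Finset.sum_congr rfl fun i _ => by ring
  have s2 : ∑ k, c * p k * (∑ i, p i * M i k) = c * q := by
    rw [hq, Finset.sum_comm, Finset.mul_sum]
    refine Finset.sum_congr rfl fun k _ => ?_
    rw [mul_assoc, Finset.mul_sum]
    congr 1
    exact Finset.sum_congr rfl fun i _ => by ring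
  rw [s1, s2, ← Finset.sum_mul, ← Finset.mul_sum, ← hP] at hs
  rw [show q / v ^ 2 = q * (1 / v ^ 2) by ring, ← hk]
  linarith

/-- scalar combination -/
lemma alg_scalar (α ψ v P H N1 z N Y κ m f g1 g2 g3 G2 A3 ft : ℝ)
    (hα : 0 < α) (hψ : 0 < ψ) (hv : 0 < v) (hP : v ^ 2 = 1 + P) (hH : 0 < H) (hm : m = 1 - κ * v)
    (hm0 : 0 < m) (hf : 0 < f) (hHv : H = N1 / v - z / v ^ 3)
    (hg1 : g1 = α * P / ψ - κ * z / (v * m))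
    (hg2 : g2 = α * z / ψ - κ * Y / (v * m))
    (hg3 : g3 = α ^ 2 * P / ψ ^ 2 - 2 * α * κ * z / (ψ * v * m) + κ ^ 2 * Y / (v ^ 2 * m ^ 2))
    (ht : ft / f = f * g1 / v ^ 2 + α / H *
      (f * (-(g1 / v ^ 3) * N1 + 3 * g1 * z / v ^ 5 - 2 * g2 / v ^ 3) + G2 / v))
    (hT : 0 ≤ -α * f / ψ + ft / f + κ * (f * g1) / (v * m))
    (hp : g1 = z / v ^ 2 + α / H *
      (-(z / v ^ 3) * N1 + 3 * z ^ 2 / v ^ 5 - 2 * Y / v ^ 3 + A3 / v))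
    (hM : -α * (H * v) / ψ - α * (P - P ^ 2 / v ^ 2) / ψ ^ 2 + G2 / f - (g3 - g1 ^ 2 / v ^ 2)
      + κ / m * ((N - 2 * Y / v ^ 2 + z ^ 2 / v ^ 4 + A3) / v)
      + κ ^ 2 / m ^ 2 * (Y / v ^ 2 - z ^ 2 / v ^ 4) ≤ 0) :
    κ * (N - 2 * Y / v ^ 2 + z ^ 2 / v ^ 4) / (v * m) ≤
      (α - 1) * (H / v) / ψ - 2 * α * z / (v ^ 4 * m * ψ) + (α + α ^ 2) * (P / v ^ 2) / ψ ^ 2 := by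
  set S2 := N - 2 * Y / v ^ 2 + z ^ 2 / v ^ 4 with hS2
  set G := G2 / f with hG
  have hG2 : G2 = G * f := by rw [hG]; field_simp
  have hN1 : N1 = v * H + z / v ^ 2 := by rw [hHv]; field_simp; ring
  have hκ : κ = (1 - m) / v := by rw [hm]; field_simp; ring
  have hP' : P = v ^ 2 - 1 := by linarith
  have hA3 : A3 = v * (H / α * (g1 - z / v ^ 2)
      - (-(z / v ^ 3) * N1 + 3 * z ^ 2 / v ^ 5 - 2 * Y / v ^ 3)) := by
    have : H / α * (g1 - z / v ^ 2) =
        (-(z / v ^ 3) * N1 + 3 * z ^ 2 / v ^ 5 - 2 * Y / v ^ 3 + A3 / v) := by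
      rw [show g1 - z / v ^ 2 = α / H *
        (-(z / v ^ 3) * N1 + 3 * z ^ 2 / v ^ 5 - 2 * Y / v ^ 3 + A3 / v) by linarith]
      field_simp
    rw [this]; field_simp; ring
  have hT2 : 0 ≤ -(H * v) / ψ + H * g1 / (α * v * m)
      + v * (-(g1 / v ^ 3) * N1 + 3 * g1 * z / v ^ 5 - 2 * g2 / v ^ 3) + G := by
    rw [ht, hG2] at hT
    have h1 : 0 ≤ (H * v / (α * f)) * (-α * f / ψ + (f * g1 / v ^ 2 + α / H *
      (f * (-(g1 / v ^ 3) * N1 + 3 * g1 * z / v ^ 5 - 2 * g2 / v ^ 3) + G * f / v))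
      + κ * (f * g1) / (v * m)) := mul_nonneg (by positivity) hT
    refine h1.trans (le_of_eq ?_)
    rw [hκ]; field_simp; ring
  have hfin : (α - 1) * (H / v) / ψ - 2 * α * z / (v ^ 4 * m * ψ)
      + (α + α ^ 2) * (P / v ^ 2) / ψ ^ 2 - κ * S2 / (v * m)
      = (-(H * v) / ψ + H * g1 / (α * v * m)
      + v * (-(g1 / v ^ 3) * N1 + 3 * g1 * z / v ^ 5 - 2 * g2 / v ^ 3) + G)
      - (-α * (H * v) / ψ - α * (P - P ^ 2 / v ^ 2) / ψ ^ 2 + G - (g3 - g1 ^ 2 / v ^ 2)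
      + κ / m * ((S2 + A3) / v)
      + κ ^ 2 / m ^ 2 * (Y / v ^ 2 - z ^ 2 / v ^ 4)) := by
    clear_value S2 G
    rw [hA3, hN1, hg1, hg2, hg3, hκ, hP']
    field_simp
    ring
  linarith

/-- derivative of `v` given derivative of `p` -/
noncomputable def dV {n : ℕ} (p : Fin n → ℝ) (v : ℝ) (dp : Fin n → ℝ) : ℝ := (∑ k, p k * dp k) / v

/-- derivative of `H` given derivatives of `p` and `U` -/
noncomputable def dHf {n : ℕ} (p : Fin n → ℝ) (U : Fin n → Fin n → ℝ) (v : ℝ) (dp : Fin n → ℝ)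
    (dU : Fin n → Fin n → ℝ) : ℝ :=
  (∑ i, dU i i) / v - (∑ i, U i i) * dV p v dp / v ^ 2
    - (∑ i, ∑ j, ((dp i * p j + p i * dp j) * U i j + p i * p j * dU i j)) / v ^ 3
    + 3 * (∑ i, ∑ j, p i * p j * U i j) * dV p v dp / v ^ 4

lemma alg_point {n : ℕ} (p : Fin n → ℝ) (U : Fin n → Fin n → ℝ) (y : Fin n → ℝ)
    (W : Fin n → Fin n → Fin n → ℝ) (F : Fin n → ℝ) (FF : Fin n → Fin n → ℝ)
    (α ψ v P H κ m f ft N1 z N Y : ℝ)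
    (hU : ∀ i j, U i j = U j i) (hy : ∀ i, ∑ k, p k * U k i = y i)
    (hW : ∀ i j k, W k i j = W i j k)
    (hα : 0 < α) (hψ : 0 < ψ) (hH : 0 < H) (hm : m = 1 - κ * v)
    (hm0 : 0 < m) (hf : 0 < f)
    (hP : P = ∑ i, p i * p i) (hv : 0 < v) (hv2 : v ^ 2 = 1 + P)
    (hN : N = ∑ i, ∑ j, U i j * U i j) (hY : Y = ∑ i, y i * y i) (hz : z = ∑ i, p i * y i)
    (hN1 : N1 = ∑ i, U i i)
    (hHv : H = (∑ i, U i i) / v - (∑ i, ∑ j, p i * p j * U i j) / v ^ 3)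
    (hcrit : ∀ i, -α * p i / ψ + F i / f + κ * (y i / v) / m = 0)
    (hPDEk : ∀ k, F k / f = (y k / v) / v
      + α / H * dHf p U v (fun i => U i k) (fun i j => W i j k))
    (hPDEt : ft / f = dV p v F / v + α / H * dHf p U v F FF)
    (hT : 0 ≤ -α * f / ψ + ft / f + κ * dV p v F / m)
    (hM : ∀ e : Fin n → ℝ, ∑ i, ∑ j, e i * e j *
      (-α * (U i j / ψ + p i * p j / ψ ^ 2) + FF i j / f - F i * F j / f ^ 2
        + κ * ((∑ k, (U k j * U k i + p k * W k i j)) / v - y i * y j / v ^ 3) / m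
        + κ ^ 2 * ((y i / v) * (y j / v)) / m ^ 2) ≤ 0) :
    κ * (N - 2 * Y / v ^ 2 + z ^ 2 / v ^ 4) / (v * m) ≤
      (α - 1) * (H / v) / ψ - 2 * α * z / (v ^ 4 * m * ψ) + (α + α ^ 2) * (P / v ^ 2) / ψ ^ 2 := by
  have hy' : ∀ i, ∑ k, p k * U i k = y i := fun i => by
    rw [← hy i]; exact Finset.sum_congr rfl fun k _ => by rw [hU]
  have e1 : ∀ q : Fin n → ℝ, ∑ i, ∑ j, p i * q j * U i j = ∑ j, y j * q j := fun q => by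
    rw [Finset.sum_comm]
    refine Finset.sum_congr rfl fun j _ => ?_
    rw [← hy j, Finset.sum_mul]
    exact Finset.sum_congr rfl fun i _ => by ring
  have e2 : ∀ q : Fin n → ℝ, ∑ i, ∑ j, q i * p j * U i j = ∑ j, y j * q j := fun q => by
    refine Finset.sum_congr rfl fun j _ => ?_
    rw [← hy' j, Finset.sum_mul]
    exact Finset.sum_congr rfl fun i _ => by ring
  have hz' : ∑ i, y i * p i = z := by
    rw [hz]; exact Finset.sum_congr rfl fun i _ => by ring
  have hFi : ∀ i, F i = f * (α * p i / ψ - κ * y i / (v * m)) := fun i => by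
    have := hcrit i
    have h2 : F i / f = α * p i / ψ - κ * y i / (v * m) := by
      have : κ * y i / (v * m) = κ * (y i / v) / m := by field_simp
      rw [this]; linear_combination hcrit i
    rw [← h2]; field_simp
  have hpF : ∑ k, p k * F k = f * (α * P / ψ - κ * z / (v * m)) := by
    have : ∀ k, p k * F k = (f * α / ψ) * (p k * p k) + (- f * κ / (v * m)) * (p k * y k) :=
      fun k => by rw [hFi]; ring
    simp only [this, Finset.sum_add_distrib, ← Finset.mul_sum]
    rw [← hP, ← hz]; ring
  have hyF : ∑ k, y k * F k = f * (α * z / ψ - κ * Y / (v * m)) := by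
    have : ∀ k, y k * F k = (f * α / ψ) * (y k * p k) + (- f * κ / (v * m)) * (y k * y k) :=
      fun k => by rw [hFi]; ring
    simp only [this, Finset.sum_add_distrib, ← Finset.mul_sum]
    rw [hz', ← hY]; ring
  have hFF2 : ∑ k, F k * F k = f ^ 2 * (α ^ 2 * P / ψ ^ 2 - 2 * α * κ * z / (ψ * v * m)
      + κ ^ 2 * Y / (v ^ 2 * m ^ 2)) := by
    have : ∀ k, F k * F k = (f * α / ψ) * (p k * F k) + (- f * κ / (v * m)) * (y k * F k) :=
      fun k => by linear_combination F k * hFi k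
    simp only [this, Finset.sum_add_distrib, ← Finset.mul_sum]
    rw [hpF, hyF]; field_simp; ring
  set g1 := α * P / ψ - κ * z / (v * m) with hg1
  set g2 := α * z / ψ - κ * Y / (v * m) with hg2
  set g3 := α ^ 2 * P / ψ ^ 2 - 2 * α * κ * z / (ψ * v * m) + κ ^ 2 * Y / (v ^ 2 * m ^ 2) with hg3
  set G2 := ∑ i, FF i i - (∑ i, ∑ j, p i * p j * FF i j) / v ^ 2 with hG2
  set A3 := ∑ i, ∑ k, p k * W k i i - (∑ i, ∑ j, ∑ k, p i * p j * (p k * W k i j)) / v ^ 2 with hA3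
  have hzU : ∑ i, ∑ j, p i * p j * U i j = z := by rw [e1, hz']
  refine alg_scalar α ψ v P H N1 z N Y κ m f g1 g2 g3 G2 A3 ft hα hψ hv hv2 hH hm hm0 hf
    ?_ hg1 hg2 hg3 ?_ ?_ ?_ ?_
  · rw [hHv, hzU, hN1]
  · rw [hPDEt]
    have h1 : ∑ i, ∑ j, ((F i * p j + p i * F j) * U i j + p i * p j * FF i j)
        = 2 * (f * g2) + ∑ i, ∑ j, p i * p j * FF i j := by
      simp only [add_mul, Finset.sum_add_distrib]
      rw [e1, e2, hyF]; ring
    unfold dHf dV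
    rw [h1, hpF, hzU, ← hN1, hG2]
    field_simp
    ring
  · refine hT.trans (le_of_eq ?_)
    unfold dV
    rw [hpF]; field_simp
  · have h0 : ∑ k, p k * (F k / f) = g1 := by
      have : ∀ k, p k * (F k / f) = (p k * F k) / f := fun k => by ring
      simp only [this, ← Finset.sum_div]
      rw [hpF]; field_simp
    have h1 : ∀ k, p k * (F k / f) = (1 / v ^ 2) * (p k * y k) + α / H * ((1 / v) * (∑ i, p k * W i i k)
        + (- N1 / v ^ 3) * (p k * y k) - (1 / v ^ 3) * (2 * ∑ i, p k * (y i * U i k)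
         + ∑ i, ∑ j, p i * p j * (p k * W i j k)) + (3 * z / v ^ 5) * (p k * y k)) := fun k => by
      have h2 : ∑ i, ∑ j, ((U i k * p j + p i * U j k) * U i j + p i * p j * W i j k)
        = 2 * (∑ i, y i * U i k) + ∑ i, ∑ j, p i * p j * W i j k := by
        simp only [add_mul, Finset.sum_add_distrib]
        rw [e1 (fun j => U j k), e2 (fun j => U j k)]; ring
      have h3 : ∑ i, ∑ j, p i * p j * (p k * W i j k) = p k * ∑ i, ∑ j, p i * p j * W i j k := by
        simp only [Finset.mul_sum]
        exact Finset.sum_congr rfl fun i _ => Finset.sum_congr rfl fun j _ => by ring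
      rw [hPDEk k]
      unfold dHf dV
      rw [h2, hy k, hzU, ← hN1, h3, ← Finset.mul_sum, ← Finset.mul_sum]
      field_simp
      ring
    have h4 : ∑ k, ∑ i, p k * (y i * U i k) = Y := by
      rw [Finset.sum_comm, hY]
      refine Finset.sum_congr rfl fun i _ => ?_
      rw [show y i * y i = y i * ∑ k, p k * U i k by rw [hy' i], Finset.mul_sum]
      exact Finset.sum_congr rfl fun k _ => by ring
    have h5 : ∑ k, ∑ i, p k * W i i k = ∑ i, ∑ k, p k * W k i i := by
      rw [Finset.sum_comm]
      exact Finset.sum_congr rfl fun j _ => Finset.sum_congr rfl fun k _ => by rw [hW _ _ k]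
    have h6 : ∑ k, ∑ i, ∑ j, p i * p j * (p k * W i j k)
        = ∑ i, ∑ j, ∑ k, p i * p j * (p k * W k i j) := by
      rw [Finset.sum_comm]
      refine Finset.sum_congr rfl fun i _ => ?_
      rw [Finset.sum_comm]
      exact Finset.sum_congr rfl fun j _ => Finset.sum_congr rfl fun k _ => by rw [hW _ _ k]
    obtain ⟨s1, hs1⟩ : ∃ s : Fin n → ℝ, ∀ k, s k = ∑ i, p k * W i i k := ⟨_, fun _ => rfl⟩
    obtain ⟨s2, hs2⟩ : ∃ s : Fin n → ℝ, ∀ k, s k = ∑ i, p k * (y i * U i k) := ⟨_, fun _ => rfl⟩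
    obtain ⟨s3, hs3⟩ : ∃ s : Fin n → ℝ, ∀ k, s k = ∑ i, ∑ j, p i * p j * (p k * W i j k) :=
      ⟨_, fun _ => rfl⟩
    simp only [← hs1, ← hs2, ← hs3] at h1 h4 h5 h6
    rw [← h0]
    simp only [h1, Finset.sum_add_distrib, Finset.sum_sub_distrib, ← Finset.mul_sum]
    rw [h4, h5, h6, ← hz, hA3]
    simp only [Finset.sum_add_distrib, ← Finset.mul_sum, h4, h6]
    field_simp
    ring
  · have h := alg_trace p _ P v hP hv hv2 hM
    refine le_trans (le_of_eq ?_) h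
    obtain ⟨q, hq⟩ : ∃ q : Fin n → Fin n → ℝ, ∀ i j, q i j = ∑ k, U k j * U k i :=
      ⟨_, fun _ _ => rfl⟩
    obtain ⟨r, hr⟩ : ∃ r : Fin n → Fin n → ℝ, ∀ i j, r i j = ∑ k, p k * W k i j :=
      ⟨_, fun _ _ => rfl⟩
    have q1 : ∑ i, q i i = N := by
      simp only [hq]; rw [hN, Finset.sum_comm]
    have q2 : ∑ i, ∑ j, p i * p j * q i j = Y := by
      have : ∀ i j, p i * p j * q i j = ∑ k, (p j * U k j) * (p i * U k i) := fun i j => by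
        rw [hq, Finset.mul_sum]; exact Finset.sum_congr rfl fun k _ => by ring
      simp only [this]
      rw [Finset.sum_congr rfl fun i _ => Finset.sum_comm, Finset.sum_comm, hY]
      refine Finset.sum_congr rfl fun k _ => ?_
      simp only [← Finset.sum_mul, ← Finset.mul_sum, hy']
    have r1 : A3 = ∑ i, r i i - (∑ i, ∑ j, p i * p j * r i j) / v ^ 2 := by
      simp only [hr, hA3, Finset.mul_sum]
    have hMij : ∀ i j, (-α * (U i j / ψ + p i * p j / ψ ^ 2) + FF i j / f - F i * F j / f ^ 2
        + κ * ((∑ k, (U k j * U k i + p k * W k i j)) / v - y i * y j / v ^ 3) / m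
        + κ ^ 2 * ((y i / v) * (y j / v)) / m ^ 2) =
        (-α / ψ) * U i j + (-α / ψ ^ 2) * (p i * p j) + (1 / f) * FF i j
        + (-1 / f ^ 2) * (F i * F j) + (κ / (m * v)) * q i j + (κ / (m * v)) * r i j
        + (-κ / (v ^ 3 * m) + κ ^ 2 / (v ^ 2 * m ^ 2)) * (y i * y j) := fun i j => by
      rw [Finset.sum_add_distrib, ← hq, ← hr]; field_simp; ring
    have hMij2 : ∀ i j, p i * p j * ((-α / ψ) * U i j + (-α / ψ ^ 2) * (p i * p j) + (1 / f) * FF i j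
        + (-1 / f ^ 2) * (F i * F j) + (κ / (m * v)) * q i j + (κ / (m * v)) * r i j
        + (-κ / (v ^ 3 * m) + κ ^ 2 / (v ^ 2 * m ^ 2)) * (y i * y j)) =
        (-α / ψ) * (p i * p j * U i j) + (-α / ψ ^ 2) * ((p i * p j) * (p i * p j))
        + (1 / f) * (p i * p j * FF i j)
        + (-1 / f ^ 2) * ((p i * p j) * (F i * F j)) + (κ / (m * v)) * (p i * p j * q i j)
        + (κ / (m * v)) * (p i * p j * r i j)
        + (-κ / (v ^ 3 * m) + κ ^ 2 / (v ^ 2 * m ^ 2)) * ((p i * p j) * (y i * y j)) :=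
      fun i j => by ring
    simp only [hMij, hMij2]
    simp only [Finset.sum_add_distrib, ← Finset.mul_sum]
    rw [hzU, sum_pp, sum_pp, sum_pp, q1, q2, hFF2, hpF, ← hz, ← hP, ← hY, ← hN1, hG2, r1,
      hHv, hzU, ← hN1]
    field_simp
    ring
lemma est_final (n : ℕ) (α ψ v P H N1 z S2 κ m : ℝ) (hα : 0 < α) (hψ : 0 < ψ) (hv : 1 ≤ v)
    (hP : v ^ 2 = 1 + P) (hH : 0 < H) (hκ : 0 < κ) (hκv : κ * v ≤ 1 / 2) (hm : m = 1 - κ * v)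
    (hHv : H = N1 / v - z / v ^ 3)
    (hS : 0 ≤ S2) (hS1 : (N1 - z / v ^ 2) ^ 2 ≤ n * S2) (hS3 : z ^ 2 ≤ (v ^ 2 * P) ^ 2 * S2)
    (h : κ * S2 / (v * m) ≤
      (α - 1) * (H / v) / ψ - 2 * α * z / (v ^ 4 * m * ψ) + (α + α ^ 2) * (P / v ^ 2) / ψ ^ 2) :
    ψ * H ≤ Real.sqrt n * ((|α - 1| * Real.sqrt n + 2 * α / κ + (α + α ^ 2) / κ) / κ + 1) := by
  have hv0 : 0 < v := by linarith
  have hm0 : 1 / 2 ≤ m := by linarith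
  have hm1 : m ≤ 1 := by nlinarith
  have hP0 : 0 ≤ P := by nlinarith
  have hvκ : v ≤ 1 / κ := by rw [le_div_iff₀ hκ]; nlinarith
  have hHv2 : H * v = N1 - z / v ^ 2 := by rw [hHv]; field_simp
  set σ := Real.sqrt S2 with hσ
  have hσ2 : σ ^ 2 = S2 := Real.sq_sqrt hS
  have hσ0 : 0 ≤ σ := Real.sqrt_nonneg _
  have hn0 : 0 ≤ Real.sqrt (n : ℝ) := Real.sqrt_nonneg _
  have hn2 : Real.sqrt (n : ℝ) ^ 2 = n := Real.sq_sqrt (Nat.cast_nonneg n)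
  have h1 : H * v ≤ Real.sqrt n * σ := by
    refine abs_le_of_sq_le_sq' (b := Real.sqrt n * σ) ?_ (by positivity) |>.2
    rw [hHv2, mul_pow, hn2, hσ2]; exact hS1
  have h2 : |z| ≤ v ^ 2 * P * σ := by
    apply abs_le_of_sq_le_sq _ (by positivity)
    rw [mul_pow, hσ2]; exact hS3
  have h1' : H ≤ Real.sqrt n * σ := by nlinarith
  set y := ψ * σ with hy
  have hy0 : 0 ≤ y := by positivity
  -- multiply the main inequality by `v m ψ²`
  have h3 : κ * y ^ 2 ≤ (α - 1) * (ψ * H) * m - 2 * α * z * ψ / v ^ 3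
      + (α + α ^ 2) * (P / v) * m := by
    have := mul_le_mul_of_nonneg_right h (show 0 ≤ v * m * ψ ^ 2 by positivity)
    have e1 : κ * S2 / (v * m) * (v * m * ψ ^ 2) = κ * y ^ 2 := by
      rw [hy, mul_pow, hσ2]; field_simp
    have e2 : ((α - 1) * (H / v) / ψ - 2 * α * z / (v ^ 4 * m * ψ)
        + (α + α ^ 2) * (P / v ^ 2) / ψ ^ 2) * (v * m * ψ ^ 2)
        = (α - 1) * (ψ * H) * m - 2 * α * z * ψ / v ^ 3 + (α + α ^ 2) * (P / v) * m := by
      field_simp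
    rw [e1, e2] at this
    exact this
  have hψH : ψ * H ≤ Real.sqrt n * y := by
    rw [hy]; linarith [mul_le_mul_of_nonneg_left h1' hψ.le]
  have h4 : (α - 1) * (ψ * H) * m ≤ |α - 1| * Real.sqrt n * y := by
    have a1 : (α - 1) * (ψ * H) * m ≤ |α - 1| * (ψ * H) * m := by
      gcongr; exact le_abs_self _
    have a2 : |α - 1| * (ψ * H) * m ≤ |α - 1| * (ψ * H) * 1 := by gcongr
    have a3 : |α - 1| * (ψ * H) ≤ |α - 1| * (Real.sqrt n * y) := by gcongr
    linarith
  have hPv : P / v ≤ 1 / κ := by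
    refine le_trans ?_ hvκ
    rw [div_le_iff₀ hv0]
    have : v * v = 1 + P := by rw [← hP]; ring
    linarith
  have h5 : - (2 * α * z * ψ / v ^ 3) ≤ 2 * α / κ * y := by
    have a1 : - (2 * α * z * ψ / v ^ 3) ≤ 2 * α * |z| * ψ / v ^ 3 := by
      rw [← neg_div]
      gcongr
      have := mul_le_mul_of_nonneg_left (neg_abs_le z) (show 0 ≤ 2 * α * ψ by positivity)
      linarith
    have a2 : 2 * α * |z| * ψ / v ^ 3 ≤ 2 * α * (v ^ 2 * P * σ) * ψ / v ^ 3 := by gcongr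
    have a3 : 2 * α * (v ^ 2 * P * σ) * ψ / v ^ 3 = 2 * α * (P / v) * y := by
      rw [hy]; field_simp
    have a4 : 2 * α * (P / v) * y ≤ 2 * α * (1 / κ) * y := by gcongr
    calc _ ≤ _ := a1
      _ ≤ _ := a2
      _ = _ := a3
      _ ≤ _ := a4
      _ = _ := by ring
  have h6 : (α + α ^ 2) * (P / v) * m ≤ (α + α ^ 2) / κ := by
    calc (α + α ^ 2) * (P / v) * m ≤ (α + α ^ 2) * (1 / κ) * 1 := by gcongr
      _ = _ := by ring
  set B := |α - 1| * Real.sqrt n + 2 * α / κ with hB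
  set E := (α + α ^ 2) / κ with hE
  have hB0 : 0 ≤ B := by positivity
  have hE0 : 0 ≤ E := by positivity
  have h7 : κ * y ^ 2 ≤ B * y + E := by
    rw [hB]; linarith
  have h8 : y ≤ (B + E) / κ + 1 := by
    by_contra hcon
    push Not at hcon
    have : (B + E) / κ < y := by linarith
    rw [div_lt_iff₀ hκ] at this
    have hy1 : 1 ≤ y := by
      have : 0 ≤ (B + E) / κ := by positivity
      linarith
    have t1 : (B + E) * y < y * κ * y := mul_lt_mul_of_pos_right this (by linarith)
    have t2 : E * 1 ≤ E * y := by gcongr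
    have t3 : κ * y ^ 2 = y * κ * y := by ring
    linarith
  exact hψH.trans (by gcongr)

noncomputable section
open Set Filter Topology

abbrev Zn (n : ℕ) := En n × ℝ

/-- directional derivative -/
def Dd {n : ℕ} (d : Zn n) (f : Zn n → ℝ) (z : Zn n) : ℝ := fderiv ℝ f z d

/-- spatial directions -/
def sp {n : ℕ} (i : Fin n) : Zn n := (EuclideanSpace.single i 1, 0)

/-- time direction -/
def tm {n : ℕ} : Zn n := (0, 1)

abbrev SmO {n : ℕ} (O : Set (Zn n)) (f : Zn n → ℝ) : Prop := ContDiffOn ℝ (⊤ : ℕ∞) f O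

section
variable {n : ℕ} {O : Set (Zn n)} {f g : Zn n → ℝ} {z d e : Zn n}

lemma SmO.diffAt (hO : IsOpen O) (hf : SmO O f) (hz : z ∈ O) : DifferentiableAt ℝ f z :=
  (hf.contDiffAt (hO.mem_nhds hz)).differentiableAt (by simp)

lemma SmO.dd (hO : IsOpen O) (hf : SmO O f) (d : Zn n) : SmO O (Dd d f) :=
  (hf.fderiv_of_isOpen hO (m := (⊤ : ℕ∞)) (by exact le_refl _)).clm_apply contDiffOn_const

lemma hasLine (hf : DifferentiableAt ℝ f z) (d : Zn n) :
    HasDerivAt (fun s : ℝ => f (z + s • d)) (Dd d f z) 0 :=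
  hf.hasFDerivAt.hasLineDerivAt d

lemma Dd_eq (hf : DifferentiableAt ℝ f z) {c : ℝ}
    (h : HasDerivAt (fun s : ℝ => f (z + s • d)) c 0) : Dd d f z = c :=
  (hasLine hf d).unique h

lemma Dd_congr (hO : IsOpen O) (h : ∀ z ∈ O, f z = g z) (hz : z ∈ O) : Dd d f z = Dd d g z := by
  unfold Dd
  have : f =ᶠ[𝓝 z] g := by filter_upwards [hO.mem_nhds hz] with w hw using h w hw
  rw [this.fderiv_eq]

lemma Dd_comm (hO : IsOpen O) (hf : SmO O f) (hz : z ∈ O) (d e : Zn n) :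
    Dd d (Dd e f) z = Dd e (Dd d f) z := by
  have hd : DifferentiableAt ℝ (fderiv ℝ f) z :=
    ((hf.fderiv_of_isOpen hO (m := (⊤ : ℕ∞)) (by exact le_refl _)).contDiffAt
      (hO.mem_nhds hz)).differentiableAt (by simp)
  have key : ∀ d e : Zn n, Dd d (Dd e f) z = fderiv ℝ (fderiv ℝ f) z d e := fun d e => by
    unfold Dd
    rw [fderiv_clm_apply hd (differentiableAt_const _)]
    simp
  rw [key, key]
  have hs : IsSymmSndFDerivAt ℝ f z :=
    (hf.contDiffAt (hO.mem_nhds hz)).isSymmSndFDerivAt (by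
      simp only [minSmoothness_of_isRCLikeNormedField]; exact WithTop.coe_le_coe.2 le_top)
  exact hs d e

lemma Dd_lin (e : Fin n → ℝ) :
    Dd (∑ i, e i • sp i) f z = ∑ i, e i * Dd (sp i) f z := by
  unfold Dd; simp

lemma Dd_sum (c : Fin n → ℝ) (F : Fin n → Zn n → ℝ) (hF : ∀ i, DifferentiableAt ℝ (F i) z) :
    Dd d (fun z => ∑ i, c i * F i z) z = ∑ i, c i * Dd d (F i) z := by
  apply Dd_eq
  · fun_prop
  · exact HasDerivAt.fun_sum fun i _ => (hasLine (hF i) d).const_mul (c i)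

/-- one-sided maximum in time -/
lemma Dd_time_nonneg (hf : DifferentiableAt ℝ f z)
    (h : ∀ᶠ s in 𝓝[<] (0:ℝ), f (z + s • tm) ≤ f z) : 0 ≤ Dd tm f z := by
  have := (hasLine hf tm).tendsto_slope_zero_left
  refine ge_of_tendsto this ?_
  filter_upwards [h, self_mem_nhdsWithin] with s hs hs0
  simp only [zero_add, zero_smul, add_zero, smul_eq_mul]
  exact mul_nonneg_of_nonpos_of_nonpos (inv_nonpos.2 (le_of_lt hs0)) (by linarith)

lemma line_mem (hO : IsOpen O) (hz : z ∈ O) (d : Zn n) : ∀ᶠ s in 𝓝 (0:ℝ), z + s • d ∈ O := by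
  have hc : Continuous fun s : ℝ => z + s • d := by fun_prop
  exact hc.continuousAt.preimage_mem_nhds (hO.mem_nhds (by simpa using hz))

lemma Dd_crit (hf : DifferentiableAt ℝ f z)
    (h : ∀ᶠ s in 𝓝 (0:ℝ), f (z + s • d) ≤ f z) : Dd d f z = 0 := by
  have hm : IsLocalMax (fun s : ℝ => f (z + s • d)) 0 := by
    filter_upwards [h] with s hs; simpa using hs
  exact hm.hasDerivAt_eq_zero (hasLine hf d)

lemma hasLine' {s : ℝ} (hf : DifferentiableAt ℝ f (z + s • d)) :
    HasDerivAt (fun s : ℝ => f (z + s • d)) (Dd d f (z + s • d)) s := by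
  have h := (hf.hasFDerivAt).comp_hasDerivAt s
    (((hasDerivAt_id s).smul_const d).const_add z)
  simp only [id_eq, one_smul] at h
  exact h

lemma Dd_hess (hO : IsOpen O) (hf : SmO O f) (hz : z ∈ O)
    (h : ∀ᶠ s in 𝓝 (0:ℝ), f (z + s • d) ≤ f z) : Dd d (Dd d f) z ≤ 0 := by
  set g : ℝ → ℝ := fun s => f (z + s • d) with hg
  have h1 : deriv g =ᶠ[𝓝 0] fun s => Dd d f (z + s • d) := by
    filter_upwards [line_mem hO hz d] with s hs
    exact (hasLine' (hf.diffAt hO hs)).deriv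
  have h2 : deriv (deriv g) 0 = Dd d (Dd d f) z := by
    rw [h1.deriv_eq]
    exact (hasLine ((hf.dd hO d).diffAt hO hz) d).deriv
  have h3 : deriv g 0 = 0 := by
    rw [(hasLine (hf.diffAt hO hz) d).deriv, Dd_crit (hf.diffAt hO hz) h]
  by_contra hcon
  push Not at hcon
  have hmin := isLocalMin_of_deriv_deriv_pos (by rw [h2]; exact hcon) h3
    (hasLine (hf.diffAt hO hz) d).continuousAt
  have hconst : g =ᶠ[𝓝 0] fun _ => g 0 := by
    filter_upwards [h, hmin] with s hs1 hs2
    apply le_antisymm _ hs2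
    simpa [hg] using hs1
  have h4 : deriv g =ᶠ[𝓝 0] fun _ => 0 := by
    have := hconst.deriv
    simpa using this
  rw [← h2, h4.deriv_eq] at hcon
  simp at hcon
end
end

noncomputable section
open Set Filter Topology

section
variable {n : ℕ}

/-- `√(1+|p|²)` -/
def vF (p : Fin n → Zn n → ℝ) (z : Zn n) : ℝ := Real.sqrt (1 + ∑ i, p i z ^ 2)

/-- the expanded mean curvature -/
def hF (p : Fin n → Zn n → ℝ) (U : Fin n → Fin n → Zn n → ℝ) (z : Zn n) : ℝ :=
  (∑ i, U i i z) / vF p z - (∑ i, ∑ j, p i z * p j z * U i j z) / vF p z ^ 3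

variable {O : Set (Zn n)} {z d : Zn n} {p : Fin n → Zn n → ℝ} {U : Fin n → Fin n → Zn n → ℝ}

lemma vF_arg_pos (p : Fin n → Zn n → ℝ) (z : Zn n) : 0 < 1 + ∑ i, p i z ^ 2 := by
  have : 0 ≤ ∑ i, p i z ^ 2 := Finset.sum_nonneg fun i _ => sq_nonneg _
  linarith

lemma vF_pos (p : Fin n → Zn n → ℝ) (z : Zn n) : 0 < vF p z := Real.sqrt_pos.2 (vF_arg_pos p z)

lemma vF_one_le (p : Fin n → Zn n → ℝ) (z : Zn n) : 1 ≤ vF p z := by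
  rw [vF, Real.one_le_sqrt]
  have : 0 ≤ ∑ i, p i z ^ 2 := Finset.sum_nonneg fun i _ => sq_nonneg _
  linarith

lemma vF_sq (p : Fin n → Zn n → ℝ) (z : Zn n) : vF p z ^ 2 = 1 + ∑ i, p i z * p i z := by
  rw [vF, Real.sq_sqrt (vF_arg_pos p z).le]; simp only [pow_two]

lemma vF_smooth {O : Set (Zn n)} (hp : ∀ i, SmO O (p i)) : SmO O (vF p) := by
  unfold SmO vF
  refine ContDiffOn.sqrt (contDiffOn_const.add (ContDiffOn.sum fun i _ => (hp i).pow 2)) ?_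
  intro z _; exact (vF_arg_pos p z).ne'

lemma hF_smooth {O : Set (Zn n)} (hp : ∀ i, SmO O (p i)) (hU : ∀ i j, SmO O (U i j)) :
    SmO O (hF p U) := by
  unfold SmO hF
  refine ContDiffOn.sub (ContDiffOn.div (ContDiffOn.sum fun i _ => hU i i) (vF_smooth hp) ?_)
    (ContDiffOn.div (ContDiffOn.sum fun i _ => ContDiffOn.sum fun j _ =>
      ((hp i).mul (hp j)).mul (hU i j)) ((vF_smooth hp).pow 3) ?_)
  · intro z _; exact (vF_pos p z).ne'
  · intro z _; exact (pow_pos (vF_pos p z) 3).ne'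

lemma vF_line (hp : ∀ i, DifferentiableAt ℝ (p i) z) (d : Zn n) :
    HasDerivAt (fun s : ℝ => vF p (z + s • d))
      (dV (fun i => p i z) (vF p z) (fun i => Dd d (p i) z)) 0 := by
  have h1 : HasDerivAt (fun s : ℝ => 1 + ∑ i, p i (z + s • d) ^ 2)
      (∑ i, 2 * (p i z * Dd d (p i) z)) 0 := by
    refine HasDerivAt.const_add 1 (HasDerivAt.fun_sum fun i _ => ?_)
    refine ((hasLine (hp i) d).pow 2).congr_deriv ?_
    simp; ring
  have h2 := h1.sqrt (by simpa using (vF_arg_pos p z).ne')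
  refine h2.congr_deriv ?_
  simp only [zero_smul, add_zero]
  rw [← Finset.mul_sum, dV]
  have : Real.sqrt (1 + ∑ i, p i z ^ 2) = vF p z := rfl
  rw [this]
  have := vF_pos p z
  field_simp

lemma hF_line (hp : ∀ i, DifferentiableAt ℝ (p i) z) (hU : ∀ i j, DifferentiableAt ℝ (U i j) z)
    (d : Zn n) :
    HasDerivAt (fun s : ℝ => hF p U (z + s • d))
      (dHf (fun i => p i z) (fun i j => U i j z) (vF p z) (fun i => Dd d (p i) z)
        (fun i j => Dd d (U i j) z)) 0 := by
  have hv := vF_line hp d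
  have hvp := vF_pos p z
  have h1 : HasDerivAt (fun s : ℝ => ∑ i, U i i (z + s • d)) (∑ i, Dd d (U i i) z) 0 :=
    HasDerivAt.fun_sum fun i _ => hasLine (hU i i) d
  have h2 : HasDerivAt (fun s : ℝ => ∑ i, ∑ j, p i (z + s • d) * p j (z + s • d)
      * U i j (z + s • d)) (∑ i, ∑ j, ((Dd d (p i) z * p j z + p i z * Dd d (p j) z) * U i j z
        + p i z * p j z * Dd d (U i j) z)) 0 := by
    refine HasDerivAt.fun_sum fun i _ => HasDerivAt.fun_sum fun j _ => ?_
    refine (((hasLine (hp i) d).mul (hasLine (hp j) d)).mul (hasLine (hU i j) d)).congr_deriv ?_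
    simp
  have h3 := (h1.div hv (by simpa using hvp.ne')).sub (h2.div (hv.pow 3) (by simpa using hvp.ne'))
  refine h3.congr_deriv ?_
  simp only [zero_smul, add_zero, Pi.pow_apply]
  unfold dHf
  field_simp
  ring

end
end

noncomputable section
open Set Filter Topology

section
variable {n : ℕ}

lemma interior_bound (O : Set (Zn n)) (hO : IsOpen O) (φ : Zn n → ℝ) (hφ : SmO O φ)
    (α a κ : ℝ) (hα : 0 < α) (hκ : 0 < κ) (p : Fin n → Zn n → ℝ) (U : Fin n → Fin n → Zn n → ℝ)
    (f ℓ : Zn n → ℝ)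
    (hp : p = fun i => Dd (sp i) φ) (hU : U = fun i j => Dd (sp j) (p i)) (hf : f = Dd tm φ)
    (ha : ∀ z ∈ O, φ z < a) (hH : ∀ z ∈ O, 0 < hF p U z)
    (hPDE : ∀ z ∈ O, f z = vF p z * hF p U z ^ α)
    (hm : ∀ z ∈ O, κ * vF p z ≤ 1 / 2)
    (hℓ : ℓ = fun z => α * Real.log (a - φ z) + Real.log (f z) - Real.log (1 - κ * vF p z))
    (z : Zn n) (hz : z ∈ O)
    (hT : ∀ᶠ s in 𝓝[<] (0:ℝ), ℓ (z + s • tm) ≤ ℓ z)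
    (hX : ∀ e : Fin n → ℝ, ∀ᶠ s in 𝓝 (0:ℝ), ℓ (z + s • (∑ i, e i • sp i)) ≤ ℓ z) :
    (a - φ z) * hF p U z ≤
      Real.sqrt n * ((|α - 1| * Real.sqrt n + 2 * α / κ + (α + α ^ 2) / κ) / κ + 1) := by
  have sp_ : ∀ i, SmO O (p i) := fun i => by rw [hp]; exact hφ.dd hO _
  have sU : ∀ i j, SmO O (U i j) := fun i j => by rw [hU]; exact (sp_ i).dd hO _
  have sf : SmO O f := by rw [hf]; exact hφ.dd hO _
  have sv : SmO O (vF p) := vF_smooth sp_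
  have hfpos : ∀ z ∈ O, 0 < f z := fun z hz => by
    rw [hPDE z hz]; exact mul_pos (vF_pos p z) (Real.rpow_pos_of_pos (hH z hz) _)
  have hψpos : ∀ z ∈ O, 0 < a - φ z := fun z hz => by linarith [ha z hz]
  have hmpos : ∀ z ∈ O, 0 < 1 - κ * vF p z := fun z hz => by linarith [hm z hz]
  have sℓ : SmO O ℓ := by
    rw [hℓ]
    refine ContDiffOn.sub (ContDiffOn.add (contDiffOn_const.mul
      (ContDiffOn.log (contDiffOn_const.sub hφ) ?_)) (ContDiffOn.log sf ?_))
      (ContDiffOn.log (contDiffOn_const.sub (contDiffOn_const.mul sv)) ?_)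
    · intro z hz; exact (hψpos z hz).ne'
    · intro z hz; exact (hfpos z hz).ne'
    · intro z hz; exact (hmpos z hz).ne'
  have Dp : ∀ i j, Dd (sp j) (p i) = U i j := fun i j => by rw [hU]
  have Dφ : ∀ i, Dd (sp i) φ = p i := fun i => by rw [hp]
  -- symmetry
  have symU : ∀ z ∈ O, ∀ i j, U i j z = U j i z := fun z hz i j => by
    rw [← Dp, ← Dp, ← Dφ, ← Dφ]; exact Dd_comm hO hφ hz _ _
  have tp : ∀ z ∈ O, ∀ i, Dd tm (p i) z = Dd (sp i) f z := fun z hz i => by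
    rw [← Dφ, hf]; exact Dd_comm hO hφ hz _ _
  have tU : ∀ z ∈ O, ∀ i j, Dd tm (U i j) z = Dd (sp j) (Dd (sp i) f) z := fun z hz i j => by
    rw [← Dp, Dd_comm hO (sp_ i) hz]
    exact Dd_congr hO (fun w hw => tp w hw i) hz
  have symW : ∀ i j k, Dd (sp j) (U k i) z = Dd (sp k) (U i j) z := fun i j k => by
    have h1 : Dd (sp j) (U k i) z = Dd (sp j) (U i k) z :=
      Dd_congr hO (fun w hw => symU w hw k i) hz
    rw [h1, ← Dp i k, ← Dp i j]
    exact Dd_comm hO (sp_ i) hz _ _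
  -- differentiated equation
  have pde : ∀ d, Dd d f z / f z = dV (fun i => p i z) (vF p z) (fun i => Dd d (p i) z) / vF p z
      + α / hF p U z * dHf (fun i => p i z) (fun i j => U i j z) (vF p z) (fun i => Dd d (p i) z)
        (fun i j => Dd d (U i j) z) := fun d => by
    have dp : ∀ i, DifferentiableAt ℝ (p i) z := fun i => (sp_ i).diffAt hO hz
    have dU : ∀ i j, DifferentiableAt ℝ (U i j) z := fun i j => (sU i j).diffAt hO hz
    have h1 := (vF_line dp d).mul ((hF_line dp dU d).rpow_const (p := α)
      (Or.inl (by simpa using (hH z hz).ne')))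
    have h2 : HasDerivAt (fun s : ℝ => f (z + s • d)) _ 0 := h1.congr_of_eventuallyEq (by
      filter_upwards [line_mem hO hz d] with s hs
      exact hPDE _ hs)
    rw [Dd_eq (sf.diffAt hO hz) h2, hPDE z hz]
    have hv := vF_pos p z
    have hHz := hH z hz
    have hHa : 0 < hF p U z ^ α := Real.rpow_pos_of_pos hHz _
    simp only [zero_smul, add_zero]
    rw [Real.rpow_sub_one hHz.ne']
    field_simp
  -- first derivative of ℓ
  have dℓ : ∀ d, ∀ z ∈ O, Dd d ℓ z = -α * Dd d φ z / (a - φ z) + Dd d f z / f z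
      + κ * dV (fun i => p i z) (vF p z) (fun i => Dd d (p i) z) / (1 - κ * vF p z) := by
    intro d z hz
    have dp : ∀ i, DifferentiableAt ℝ (p i) z := fun i => (sp_ i).diffAt hO hz
    apply Dd_eq (sℓ.diffAt hO hz)
    have h1 := ((hasLine (hφ.diffAt hO hz) d).const_sub a).log (by simpa using (hψpos z hz).ne')
    have h2 := (hasLine (sf.diffAt hO hz) d).log (by simpa using (hfpos z hz).ne')
    have h3 := (((vF_line dp d).const_mul κ).const_sub 1).log (by simpa using (hmpos z hz).ne')
    have h4 := ((h1.const_mul α).add h2).sub h3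
    rw [hℓ]
    refine h4.congr_deriv ?_
    simp only [zero_smul, add_zero]
    ring
  have dℓi : ∀ i, ∀ z ∈ O, Dd (sp i) ℓ z = -α * p i z / (a - φ z) + Dd (sp i) f z / f z
      + κ * ((∑ k, p k z * U k i z) / vF p z) / (1 - κ * vF p z) := by
    intro i z hz
    rw [dℓ _ z hz]
    simp only [dV, Dp, Dφ]
  have ddℓ : ∀ i j, Dd (sp j) (Dd (sp i) ℓ) z =
      (-α * (U i j z / (a - φ z) + p i z * p j z / (a - φ z) ^ 2) + Dd (sp j) (Dd (sp i) f) z / f z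
        - Dd (sp i) f z * Dd (sp j) f z / f z ^ 2
        + κ * ((∑ k, (U k j z * U k i z + p k z * Dd (sp j) (U k i) z)) / vF p z
          - (∑ k, p k z * U k i z) * (∑ k, p k z * U k j z) / vF p z ^ 3) / (1 - κ * vF p z)
        + κ ^ 2 * (((∑ k, p k z * U k i z) / vF p z) * ((∑ k, p k z * U k j z) / vF p z))
          / (1 - κ * vF p z) ^ 2) := by
    intro i j
    have dp : ∀ i, DifferentiableAt ℝ (p i) z := fun i => (sp_ i).diffAt hO hz
    apply Dd_eq (((sℓ.dd hO _)).diffAt hO hz)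
    have hy : HasDerivAt (fun s : ℝ => ∑ k, p k (z + s • sp j) * U k i (z + s • sp j))
        (∑ k, (U k j z * U k i z + p k z * Dd (sp j) (U k i) z)) 0 := by
      refine HasDerivAt.fun_sum fun k _ => ?_
      refine ((hasLine (dp k) (sp j)).mul (hasLine ((sU k i).diffAt hO hz) (sp j))).congr_deriv ?_
      simp [Dp]
    have hv := vF_line dp (sp j)
    have h1 := ((hasLine (dp i) (sp j)).const_mul (-α)).div
      ((hasLine (hφ.diffAt hO hz) (sp j)).const_sub a) (by simpa using (hψpos z hz).ne')
    have h2 := (hasLine ((sf.dd hO (sp i)).diffAt hO hz) (sp j)).div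
      (hasLine (sf.diffAt hO hz) (sp j)) (by simpa using (hfpos z hz).ne')
    have h3 := ((hy.div hv (by simpa using (vF_pos p z).ne')).const_mul κ).div
      ((hv.const_mul κ).const_sub 1) (by simpa using (hmpos z hz).ne')
    have h4 : HasDerivAt (fun s : ℝ => Dd (sp i) ℓ (z + s • sp j)) _ 0 :=
      ((h1.add h2).add h3).congr_of_eventuallyEq (by
      filter_upwards [line_mem hO hz (sp j)] with s hs
      exact dℓi i _ hs)
    refine h4.congr_deriv ?_
    have e1 := vF_pos p z
    have e2 := hψpos z hz
    have e3 := hfpos z hz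
    have e4 := hmpos z hz
    simp only [zero_smul, add_zero, dV, Dp, Dφ, Pi.div_apply]
    generalize vF p z = v at *
    generalize ∑ k, p k z * U k i z = yi at *
    generalize ∑ k, p k z * U k j z = yj at *
    generalize ∑ k, (U k j z * U k i z + p k z * Dd (sp j) (U k i) z) = q at *
    have e4' : 1 - κ * v ≠ 0 := e4.ne'
    generalize hmm : 1 - κ * v = m at *
    generalize a - φ z = ψ at *
    field_simp
    ring
  have dfi := sℓ.diffAt hO hz
  have hT' := Dd_time_nonneg dfi hT
  rw [dℓ tm z hz] at hT'
  simp only [tp z hz] at hT'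
  have hcrit : ∀ i, Dd (sp i) ℓ z = 0 := fun i => by
    refine Dd_crit dfi ?_
    have := hX (Pi.single i 1)
    have e : ∑ j, (Pi.single i (1:ℝ) : Fin n → ℝ) j • (sp j : Zn n) = sp i := by
      rw [Finset.sum_eq_single i]
      · simp
      · intro j _ hj; simp [hj]
      · simp
    rw [e] at this; exact this
  have hHess : ∀ e : Fin n → ℝ, ∑ i, ∑ j, e i * e j * Dd (sp j) (Dd (sp i) ℓ) z ≤ 0 := fun e => by
    have h := Dd_hess hO sℓ hz (hX e)
    rw [Dd_congr hO (fun w _ => Dd_lin e) hz, Dd_sum e (fun i => Dd (sp i) ℓ)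
      (fun i => (sℓ.dd hO (sp i)).diffAt hO hz)] at h
    refine le_trans (le_of_eq ?_) h
    refine Finset.sum_congr rfl fun i _ => ?_
    rw [Dd_lin, Finset.mul_sum]
    exact Finset.sum_congr rfl fun j _ => by ring
  simp only [ddℓ] at hHess
  have pk : ∀ k, Dd (sp k) f z / f z = ((∑ i, p i z * U i k z) / vF p z) / vF p z
      + α / hF p U z * dHf (fun i => p i z) (fun i j => U i j z) (vF p z) (fun i => U i k z)
        (fun i j => Dd (sp k) (U i j) z) := fun k => by
    rw [pde (sp k)]; simp only [Dp, dV]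
  have pt := pde tm
  simp only [tp z hz, tU z hz] at pt
  have crit' : ∀ i, -α * p i z / (a - φ z) + Dd (sp i) f z / f z
      + κ * ((∑ k, p k z * U k i z) / vF p z) / (1 - κ * vF p z) = 0 := fun i => by
    rw [← dℓi i z hz]; exact hcrit i
  rw [← hf] at hT'
  have main := alg_point (fun i => p i z) (fun i j => U i j z) (fun i => ∑ k, p k z * U k i z)
    (fun i j k => Dd (sp k) (U i j) z) (fun i => Dd (sp i) f z)
    (fun i j => Dd (sp j) (Dd (sp i) f) z) α (a - φ z) (vF p z) _ (hF p U z) κ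
    (1 - κ * vF p z) (f z) (Dd tm f z) _ _ _ _ (symU z hz) (fun i => rfl) symW hα (hψpos z hz)
    (hH z hz) rfl (hmpos z hz) (hfpos z hz) rfl (vF_pos p z) (vF_sq p z) rfl rfl rfl rfl rfl
    crit' pk pt hT' hHess
  obtain ⟨s1, s2, s3⟩ := alg_S (fun i => p i z) (fun i j => U i j z)
    (fun i => ∑ k, p k z * U k i z) (symU z hz) (fun i => rfl) _ (vF p z) _ _ _ _ rfl (vF_pos p z)
    (vF_sq p z) rfl rfl rfl rfl
  refine est_final n α (a - φ z) (vF p z) _ (hF p U z) _ _ _ κ _ hα (hψpos z hz) (vF_one_le p z)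
    (vF_sq p z) (hH z hz) hκ (hm z hz) rfl ?_ s1 s2 s3 main
  unfold hF
  congr 2
  rw [Finset.sum_comm]
  refine Finset.sum_congr rfl fun i _ => ?_
  rw [Finset.mul_sum]
  exact Finset.sum_congr rfl fun j _ => by ring

end
end

noncomputable section
open Set Filter Topology

section
variable {n : ℕ}

lemma pd_smooth {U : Set (En n)} (hU : IsOpen U) {T : ℝ} (hT : 0 < T) (f : Zn n → ℝ)
    (hf : ContDiffOn ℝ (⊤ : ℕ∞) f (U ×ˢ Icc 0 T)) (i : Fin n) :
    ContDiffOn ℝ (⊤ : ℕ∞) (fun z : Zn n => pd (fun y => f (y, z.2)) i z.1) (U ×ˢ Icc 0 T) := by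
  have hud : UniqueDiffOn ℝ (U ×ˢ Icc 0 T) := hU.uniqueDiffOn.prod (uniqueDiffOn_Icc hT)
  have h1 : ContDiffOn ℝ (⊤ : ℕ∞) (fun z => fderivWithin ℝ f (U ×ˢ Icc 0 T) z (sp i))
      (U ×ˢ Icc 0 T) :=
    (hf.fderivWithin hud (m := (⊤ : ℕ∞)) (by exact le_refl _)).clm_apply contDiffOn_const
  refine h1.congr ?_
  rintro ⟨x, t⟩ ⟨hx, ht⟩
  have hd : HasFDerivWithinAt f (fderivWithin ℝ f (U ×ˢ Icc 0 T) (x, t)) (U ×ˢ Icc 0 T) (x, t) :=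
    ((hf.differentiableOn (by simp)) (x, t) ⟨hx, ht⟩).hasFDerivWithinAt
  have hg : HasFDerivWithinAt (fun y : En n => ((y, t) : Zn n))
      (ContinuousLinearMap.inl ℝ (En n) ℝ) U x := (hasFDerivAt_prodMk_left x t).hasFDerivWithinAt
  have hmaps : MapsTo (fun y : En n => ((y, t) : Zn n)) U (U ×ˢ Icc 0 T) := fun y hy => ⟨hy, ht⟩
  have hc := (HasFDerivWithinAt.comp (g := f) (f := fun y : En n => ((y, t) : Zn n)) x hd hg
    hmaps).hasFDerivAt (hU.mem_nhds hx)
  unfold pd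
  have : (fun y => f (y, t)) = f ∘ (fun y : En n => ((y, t) : Zn n)) := rfl
  simp only
  rw [this, hc.fderiv]
  simp [sp]

lemma pd_eq_Dd {f : Zn n → ℝ} {z : Zn n} (hf : DifferentiableAt ℝ f z) (i : Fin n) :
    pd (fun y => f (y, z.2)) i z.1 = Dd (sp i) f z := by
  have hg : HasFDerivAt (fun y : En n => ((y, z.2) : Zn n))
      (ContinuousLinearMap.inl ℝ (En n) ℝ) z.1 := hasFDerivAt_prodMk_left z.1 z.2
  have hc := HasFDerivAt.comp z.1 (f := fun y : En n => ((y, z.2) : Zn n)) hf.hasFDerivAt hg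
  unfold pd Dd
  have : (fun y => f (y, z.2)) = f ∘ (fun y : En n => ((y, z.2) : Zn n)) := rfl
  rw [this, hc.fderiv]
  simp [sp]

lemma deriv_eq_Dd {f : Zn n → ℝ} {z : Zn n} (hf : DifferentiableAt ℝ f z) :
    deriv (fun t => f (z.1, t)) z.2 = Dd tm f z := by
  have hg : HasFDerivAt (fun t : ℝ => ((z.1, t) : Zn n))
      (ContinuousLinearMap.inr ℝ (En n) ℝ) z.2 := hasFDerivAt_prodMk_right z.1 z.2
  have hc := HasFDerivAt.comp z.2 (f := fun t : ℝ => ((z.1, t) : Zn n)) hf.hasFDerivAt hg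
  have : (fun t => f (z.1, t)) = f ∘ (fun t : ℝ => ((z.1, t) : Zn n)) := rfl
  rw [this, hc.hasDerivAt.deriv]
  simp [tm, Dd]

/-- spatial partials as functions on space-time -/
def Pf (u : En n → ℝ → ℝ) (i : Fin n) (z : Zn n) : ℝ := pd (fun y => u y z.2) i z.1

/-- mean curvature as a function on space-time -/
def Hf (u : En n → ℝ → ℝ) (z : Zn n) : ℝ := meanCurv (fun y => u y z.2) z.1

lemma graphV_eq (u : En n → ℝ → ℝ) (z : Zn n) :
    graphV (fun y => u y z.2) z.1 = vF (Pf u) z := rfl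

lemma Hf_eq (u : En n → ℝ → ℝ) (z : Zn n) :
    Hf u z = ∑ i, pd (fun y => (fun w => Pf u i w / vF (Pf u) w) (y, z.2)) i z.1 := rfl

lemma Pf_smooth {U : Set (En n)} (hU : IsOpen U) {T : ℝ} (hT : 0 < T) (u : En n → ℝ → ℝ)
    (hu : ContDiffOn ℝ (⊤ : ℕ∞) (fun p : En n × ℝ => u p.1 p.2) (U ×ˢ Icc 0 T)) (i : Fin n) :
    ContDiffOn ℝ (⊤ : ℕ∞) (Pf u i) (U ×ˢ Icc 0 T) :=
  pd_smooth hU hT _ hu i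

lemma Hf_smooth {U : Set (En n)} (hU : IsOpen U) {T : ℝ} (hT : 0 < T) (u : En n → ℝ → ℝ)
    (hu : ContDiffOn ℝ (⊤ : ℕ∞) (fun p : En n × ℝ => u p.1 p.2) (U ×ˢ Icc 0 T)) :
    ContDiffOn ℝ (⊤ : ℕ∞) (Hf u) (U ×ˢ Icc 0 T) := by
  have : Hf u = fun z => ∑ i, pd (fun y => (fun w => Pf u i w / vF (Pf u) w) (y, z.2)) i z.1 := rfl
  rw [this]
  refine ContDiffOn.sum fun i _ => pd_smooth hU hT (fun w => Pf u i w / vF (Pf u) w) ?_ i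
  exact (Pf_smooth hU hT u hu i).div (vF_smooth (Pf_smooth hU hT u hu))
    (fun z _ => (vF_pos _ z).ne')

lemma Hf_expand {O : Set (Zn n)} (hO : IsOpen O) (u : En n → ℝ → ℝ)
    (hu : SmO O (fun p : Zn n => u p.1 p.2))
    (p : Fin n → Zn n → ℝ) (U : Fin n → Fin n → Zn n → ℝ)
    (hp : p = fun i => Dd (sp i) (fun p : Zn n => u p.1 p.2)) (hU : U = fun i j => Dd (sp j) (p i))
    (z : Zn n) (hz : z ∈ O) : vF (Pf u) z = vF p z ∧ Hf u z = hF p U z := by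
  have sp_ : ∀ i, SmO O (p i) := fun i => by rw [hp]; exact hu.dd hO _
  have hPp : ∀ z ∈ O, ∀ i, Pf u i z = p i z := fun z hz i => by
    rw [hp]; exact pd_eq_Dd (hu.diffAt hO hz) i
  have hV : ∀ z ∈ O, vF (Pf u) z = vF p z := fun z hz => by
    unfold vF; simp only [hPp z hz]
  refine ⟨hV z hz, ?_⟩
  have sq : ∀ i, SmO O (fun w => p i w / vF p w) := fun i =>
    (sp_ i).div (vF_smooth sp_) (fun z _ => (vF_pos _ z).ne')
  have sq' : ∀ i, SmO O (fun w => Pf u i w / vF (Pf u) w) := fun i =>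
    (sq i).congr (fun w hw => by rw [hPp w hw, hV w hw])
  have Dp : ∀ i j, Dd (sp j) (p i) = U i j := fun i j => by rw [hU]
  have key : ∀ i, pd (fun y => (fun w => Pf u i w / vF (Pf u) w) (y, z.2)) i z.1
      = U i i z / vF p z - (∑ k, p k z * p i z * U k i z) / vF p z ^ 3 := fun i => by
    rw [pd_eq_Dd ((sq' i).diffAt hO hz) i,
      Dd_congr hO (g := fun w => p i w / vF p w) (fun w hw => by rw [hPp w hw, hV w hw]) hz]
    apply Dd_eq ((sq i).diffAt hO hz)
    have h := (hasLine ((sp_ i).diffAt hO hz) (sp i)).div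
      (vF_line (fun k => (sp_ k).diffAt hO hz) (sp i)) (by simpa using (vF_pos p z).ne')
    refine h.congr_deriv ?_
    simp only [zero_smul, add_zero, dV, Dp]
    have : ∑ k, p k z * p i z * U k i z = p i z * ∑ k, p k z * U k i z := by
      rw [Finset.mul_sum]; exact Finset.sum_congr rfl fun k _ => by ring
    rw [this]
    have := vF_pos p z
    field_simp
  rw [Hf_eq]
  simp only [key, Finset.sum_sub_distrib, ← Finset.sum_div]
  unfold hF
  congr 2
  rw [Finset.sum_comm]

lemma early (u : En n → ℝ → ℝ) (a T : ℝ) (x : En n)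
    (hc : ContinuousOn (u x) (Icc 0 T))
    (hd : ∀ t ∈ Icc (0:ℝ) T, u x t < a + 1 → 0 < deriv (u x) t) (t : ℝ) (ht : t ∈ Icc (0:ℝ) T)
    (h : u x t ≤ a) : u x 0 ≤ a := by
  obtain ⟨s, hs, hmin⟩ := isCompact_Icc.exists_isMinOn (s := Icc 0 t) ⟨0, by simp [ht.1]⟩
    (hc.mono (Icc_subset_Icc_right ht.2))
  have hst : u x s ≤ u x t := hmin (right_mem_Icc.2 ht.1)
  have hds := hd s ⟨hs.1, hs.2.trans ht.2⟩ (by linarith)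
  rcases eq_or_lt_of_le hs.1 with h0 | h0
  · rw [h0]; linarith
  · exfalso
    have hdiff : HasDerivAt (u x) (deriv (u x) s) s := by
      apply DifferentiableAt.hasDerivAt
      by_contra hcon
      rw [deriv_zero_of_not_differentiableAt hcon] at hds
      exact lt_irrefl _ hds
    have := hdiff.tendsto_slope_zero_left
    have h2 : deriv (u x) s ≤ 0 := by
      refine le_of_tendsto this ?_
      have hIoo : Ioo (-s) 0 ∈ 𝓝[<] (0:ℝ) := Ioo_mem_nhdsLT (by linarith)
      filter_upwards [hIoo] with r hr
      have : u x s ≤ u x (s + r) := hmin ⟨by linarith [hr.1], by linarith [hr.2, hs.2]⟩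
      exact mul_nonpos_of_nonpos_of_nonneg (inv_nonpos.2 hr.2.le) (by linarith)
    linarith

end
end

noncomputable section
open Set Filter Topology

section
variable {n : ℕ}

/-- the constant of the interior estimate -/
def Kc (n : ℕ) (α κ : ℝ) : ℝ :=
  Real.sqrt n * ((|α - 1| * Real.sqrt n + 2 * α / κ + (α + α ^ 2) / κ) / κ + 1)

/-- the test function -/
def Qf (α a κ : ℝ) (u : En n → ℝ → ℝ) (z : Zn n) : ℝ :=
  (max (a - u z.1 z.2) 0 * Hf u z) ^ α * vF (Pf u) z / max (1 - κ * vF (Pf u) z) (1 / 2)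

lemma Qf_cont {α a κ : ℝ} (hα : 0 < α) {U : Set (En n)} (hU : IsOpen U) {T : ℝ} (hT : 0 < T)
    (u : En n → ℝ → ℝ)
    (hu : ContDiffOn ℝ (⊤ : ℕ∞) (fun p : En n × ℝ => u p.1 p.2) (U ×ˢ Icc 0 T)) :
    ContinuousOn (Qf α a κ u) (U ×ˢ Icc 0 T) := by
  have h1 := hu.continuousOn
  have h2 := (Hf_smooth hU hT u hu).continuousOn
  have h3 : ContinuousOn (vF (Pf u)) (U ×ˢ Icc 0 T) :=
    ContDiffOn.continuousOn (𝕜 := ℝ) (n := (⊤ : ℕ∞)) (vF_smooth (Pf_smooth hU hT u hu))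
  unfold Qf
  refine ContinuousOn.div (ContinuousOn.mul (ContinuousOn.rpow_const ?_ fun _ _ => Or.inr hα.le) h3) ?_ ?_
  · exact ((continuousOn_const.sub h1).sup continuousOn_const).mul h2
  · exact (continuousOn_const.sub (continuousOn_const.mul h3)).sup continuousOn_const
  · intro z _
    have : (1:ℝ) / 2 ≤ max (1 - κ * vF (Pf u) z) (1 / 2) := le_max_right _ _
    intro h; rw [h] at this; norm_num at this

lemma Qf_pos_of {α a κ : ℝ} (hα : 0 < α) (u : En n → ℝ → ℝ) (z : Zn n) (h : 0 < Qf α a κ u z) :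
    u z.1 z.2 < a := by
  by_contra hc
  push Not at hc
  unfold Qf at h
  rw [max_eq_right (by linarith : a - u z.1 z.2 ≤ 0), zero_mul, Real.zero_rpow hα.ne'] at h
  simp at h

lemma Qf_eq {α a κ : ℝ} (u : En n → ℝ → ℝ) (z : Zn n)
    (hua : u z.1 z.2 < a) (hm : κ * vF (Pf u) z ≤ 1 / 2) :
    Qf α a κ u z = ((a - u z.1 z.2) * Hf u z) ^ α * vF (Pf u) z / (1 - κ * vF (Pf u) z) := by
  unfold Qf
  rw [max_eq_left (by linarith : 0 ≤ a - u z.1 z.2), max_eq_left (by linarith)]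

lemma Qf_lower {α a κ : ℝ} (hκ : 0 < κ) (u : En n → ℝ → ℝ) (z : Zn n)
    (hua : u z.1 z.2 < a) (hH : 0 < Hf u z) (hm : κ * vF (Pf u) z ≤ 1 / 2) :
    ((a - u z.1 z.2) * Hf u z) ^ α ≤ Qf α a κ u z := by
  rw [Qf_eq u z hua hm, le_div_iff₀ (by linarith)]
  have h1 : 0 ≤ ((a - u z.1 z.2) * Hf u z) ^ α :=
    Real.rpow_nonneg (mul_nonneg (by linarith) hH.le) _
  have h2 := vF_one_le (Pf u) z
  apply mul_le_mul_of_nonneg_left _ h1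
  nlinarith

lemma Qf_upper {α a κ : ℝ} (hκ : 0 < κ) (u : En n → ℝ → ℝ) (z : Zn n)
    (hua : u z.1 z.2 < a) (hH : 0 < Hf u z) (hm : κ * vF (Pf u) z ≤ 1 / 2) :
    Qf α a κ u z ≤ ((a - u z.1 z.2) * Hf u z) ^ α / κ := by
  rw [Qf_eq u z hua hm, mul_div_assoc, div_eq_mul_inv _ κ]
  have h1 : 0 ≤ ((a - u z.1 z.2) * Hf u z) ^ α :=
    Real.rpow_nonneg (mul_nonneg (by linarith) hH.le) _
  apply mul_le_mul_of_nonneg_left _ h1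
  rw [div_le_iff₀ (by linarith), ← div_eq_inv_mul, le_div_iff₀ hκ]
  linarith

lemma interior_apply {α a κ : ℝ} (hα : 0 < α) (hκ : 0 < κ) {U : Set (En n)} (hU : IsOpen U)
    {T : ℝ} (u : En n → ℝ → ℝ)
    (hu : ContDiffOn ℝ (⊤ : ℕ∞) (fun p : En n × ℝ => u p.1 p.2) (U ×ˢ Icc 0 T))
    (hH : ∀ z ∈ U ×ˢ Icc 0 T, u z.1 z.2 < a → 0 < Hf u z)
    (hE : ∀ z ∈ U ×ˢ Icc 0 T, u z.1 z.2 < a → deriv (u z.1) z.2 = vF (Pf u) z * Hf u z ^ α)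
    (hm : ∀ z ∈ U ×ˢ Icc 0 T, u z.1 z.2 < a → κ * vF (Pf u) z ≤ 1 / 2)
    (z : Zn n) (hz : z ∈ U ×ˢ Ioo 0 T) (hza : u z.1 z.2 < a)
    (hmax : ∀ y ∈ U ×ˢ Icc 0 T, u y.1 y.2 < a → y.2 ≤ z.2 → Qf α a κ u y ≤ Qf α a κ u z) :
    (a - u z.1 z.2) * Hf u z ≤ Kc n α κ := by
  have hsub : U ×ˢ Ioo 0 T ⊆ U ×ˢ Icc 0 T := prod_mono_right Ioo_subset_Icc_self
  set φ : Zn n → ℝ := fun p => u p.1 p.2 with hφ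
  set O : Set (Zn n) := (U ×ˢ Ioo 0 T) ∩ φ ⁻¹' (Iio a) with hOdef
  have hO : IsOpen O :=
    (hu.continuousOn.mono hsub).isOpen_inter_preimage (hU.prod isOpen_Ioo) isOpen_Iio
  have hOD : ∀ y ∈ O, y ∈ U ×ˢ Icc 0 T := fun y hy => hsub hy.1
  have hs : SmO O φ := hu.mono hOD
  have hzO : z ∈ O := ⟨hz, hza⟩
  obtain ⟨p, hp⟩ : ∃ p : Fin n → Zn n → ℝ, p = fun i => Dd (sp i) φ := ⟨_, rfl⟩
  obtain ⟨W, hW⟩ : ∃ W : Fin n → Fin n → Zn n → ℝ, W = fun i j => Dd (sp j) (p i) := ⟨_, rfl⟩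
  have hex := fun y hy => Hf_expand hO u hs p W hp hW y hy
  obtain ⟨ℓ, hℓ⟩ : ∃ ℓ : Zn n → ℝ, ℓ = fun z => α * Real.log (a - φ z) + Real.log (Dd tm φ z)
    - Real.log (1 - κ * vF p z) := ⟨_, rfl⟩
  have hPDE : ∀ y ∈ O, Dd tm φ y = vF p y * hF p W y ^ α := fun y hy => by
    rw [← deriv_eq_Dd (hs.diffAt hO hy), ← (hex y hy).1, ← (hex y hy).2]
    exact hE y (hOD y hy) hy.2
  have hlog : ∀ y ∈ O, 0 < Qf α a κ u y ∧ ℓ y = Real.log (Qf α a κ u y) := fun y hy => by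
    have e1 := hH y (hOD y hy) hy.2
    have e2 := hm y (hOD y hy) hy.2
    have e3 : 0 < a - u y.1 y.2 := sub_pos.2 hy.2
    have e4 := vF_pos (Pf u) y
    have e5 : 0 < 1 - κ * vF (Pf u) y := by linarith
    rw [Qf_eq u y hy.2 e2, hℓ]
    refine ⟨by positivity, ?_⟩
    simp only
    rw [hPDE y hy, ← (hex y hy).1, ← (hex y hy).2, Real.log_div (by positivity) e5.ne',
      Real.log_mul (by positivity) e4.ne', Real.log_mul e4.ne' (by positivity),
      Real.log_rpow e1, Real.log_rpow (mul_pos e3 e1), Real.log_mul e3.ne' e1.ne']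
    simp only [hφ]
    ring
  have hcmp : ∀ y ∈ O, y.2 ≤ z.2 → ℓ y ≤ ℓ z := fun y hy hyz => by
    rw [(hlog y hy).2, (hlog z hzO).2]
    exact Real.log_le_log (hlog y hy).1 (hmax y (hOD y hy) hy.2 hyz)
  have hkey := interior_bound O hO φ hs α a κ hα hκ p W (Dd tm φ) ℓ hp hW rfl
    (fun y hy => hy.2) (fun y hy => by rw [← (hex y hy).2]; exact hH y (hOD y hy) hy.2) hPDE
    (fun y hy => by rw [← (hex y hy).1]; exact hm y (hOD y hy) hy.2) hℓ z hzO ?_ ?_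
  · rw [(hex z hzO).2]; exact hkey
  · filter_upwards [(line_mem hO hzO tm).filter_mono nhdsWithin_le_nhds, self_mem_nhdsWithin]
      with s h1 h2
    refine hcmp _ h1 ?_
    have : s < 0 := h2
    simp [tm]; linarith
  · intro e
    filter_upwards [line_mem hO hzO (∑ i, e i • sp i)] with s h1
    refine hcmp _ h1 ?_
    simp [sp, Prod.snd_sum]

lemma step {α a κ : ℝ} (hα : 0 < α) (hκ : 0 < κ) {U : Set (En n)} (hU : IsOpen U)
    {T : ℝ} (hT : 0 < T) (u : En n → ℝ → ℝ)
    (hu : ContDiffOn ℝ (⊤ : ℕ∞) (fun p : En n × ℝ => u p.1 p.2) (U ×ˢ Icc 0 T))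
    (hK0 : IsCompact {x ∈ U | u x 0 ≤ a})
    (hH : ∀ z ∈ U ×ˢ Icc 0 T, u z.1 z.2 < a + 1 → 0 < Hf u z)
    (hE : ∀ z ∈ U ×ˢ Icc 0 T, u z.1 z.2 < a + 1 → deriv (u z.1) z.2 = vF (Pf u) z * Hf u z ^ α)
    (hm : ∀ z ∈ U ×ˢ Icc 0 T, u z.1 z.2 < a → κ * vF (Pf u) z ≤ 1 / 2)
    (M : ℝ) (hM : ∀ y ∈ U, u y 0 < a → (a - u y 0) * Hf u (y, 0) ≤ M) (hM1 : Kc n α κ ≤ M)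
    (hM0 : 0 ≤ M)
    (z : Zn n) (hz : z ∈ U ×ˢ Ico 0 T) (hza : u z.1 z.2 < a) :
    (a - u z.1 z.2) * Hf u z ≤ M * κ ^ (-1 / α) := by
  obtain ⟨x, t⟩ := z
  obtain ⟨hx, ht⟩ := hz
  simp only at hx ht hza
  have htT : t ∈ Icc 0 T := ⟨ht.1, ht.2.le⟩
  have hzD : ((x, t) : Zn n) ∈ U ×ˢ Icc 0 T := ⟨hx, htT⟩
  have hear : ∀ y ∈ U, ∀ s ∈ Icc 0 T, u y s ≤ a → u y 0 ≤ a := fun y hy s hs hya => by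
    refine early u a T y ?_ ?_ s hs hya
    · exact ContinuousOn.comp (g := fun p : En n × ℝ => u p.1 p.2) hu.continuousOn
        (by fun_prop : ContinuousOn (fun s : ℝ => ((y, s) : En n × ℝ)) (Icc 0 T))
        (fun s hs => ⟨hy, hs⟩)
    · intro r hr hra
      have h1 := hH (y, r) ⟨hy, hr⟩ hra
      have h2 := hE (y, r) ⟨hy, hr⟩ hra
      have h3 := vF_pos (Pf u) (y, r)
      simp only at h2
      rw [h2]; positivity
  set K0 := {x ∈ U | u x 0 ≤ a}
  have hK1 : IsCompact (K0 ×ˢ Icc 0 t) := hK0.prod isCompact_Icc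
  have hKD : K0 ×ˢ Icc 0 t ⊆ U ×ˢ Icc 0 T :=
    prod_mono (fun y hy => hy.1) (Icc_subset_Icc_right ht.2.le)
  have hcl : IsClosed ((K0 ×ˢ Icc 0 t) ∩ (fun p : En n × ℝ => u p.1 p.2) ⁻¹' (Iic a)) :=
    (hu.continuousOn.mono hKD).preimage_isClosed_of_isClosed hK1.isClosed isClosed_Iic
  have hK : IsCompact ((K0 ×ˢ Icc 0 t) ∩ (fun p : En n × ℝ => u p.1 p.2) ⁻¹' (Iic a)) :=
    hK1.of_isClosed_subset hcl inter_subset_left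
  have hzK : ((x, t) : Zn n) ∈ (K0 ×ˢ Icc 0 t) ∩ (fun p : En n × ℝ => u p.1 p.2) ⁻¹' (Iic a) :=
    ⟨⟨⟨hx, hear x hx t htT hza.le⟩, right_mem_Icc.2 ht.1⟩, hza.le⟩
  obtain ⟨z0, hz0, hmax⟩ := hK.exists_isMaxOn ⟨_, hzK⟩
    ((Qf_cont (a := a) (κ := κ) hα hU hT u hu).mono (inter_subset_left.trans hKD))
  have hz0D := hKD hz0.1
  have hHz := hH (x, t) hzD (by simp only; linarith)
  have hlow := Qf_lower (α := α) hκ u (x, t) hza hHz (hm _ hzD hza)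
  have hpos : 0 < ((a - u x t) * Hf u (x, t)) ^ α :=
    Real.rpow_pos_of_pos (mul_pos (by linarith) hHz) _
  have hle : Qf α a κ u (x, t) ≤ Qf α a κ u z0 := hmax hzK
  simp only at hlow
  have hz0a : u z0.1 z0.2 < a := Qf_pos_of hα u z0 (by linarith)
  have hHz0 := hH z0 hz0D (by linarith)
  have hup := Qf_upper (α := α) hκ u z0 hz0a hHz0 (hm _ hz0D hz0a)
  have hb : (a - u z0.1 z0.2) * Hf u z0 ≤ M := by
    rcases eq_or_lt_of_le hz0.1.2.1 with h0 | h0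
    · obtain ⟨y, s⟩ := z0
      simp only at h0
      subst h0
      exact hM y hz0D.1 hz0a
    · refine le_trans (interior_apply hα hκ hU u hu (fun z hz h => hH z hz (by linarith))
        (fun z hz h => hE z hz (by linarith)) hm z0
        ⟨hz0D.1, h0, lt_of_le_of_lt hz0.1.2.2 ht.2⟩ hz0a ?_) hM1
      intro y hy hya hyz
      exact hmax (⟨⟨⟨hy.1, hear _ hy.1 _ hy.2 hya.le⟩, hy.2.1, hyz.trans hz0.1.2.2⟩, hya.le⟩)
  have h1 : ((a - u z0.1 z0.2) * Hf u z0) ^ α ≤ M ^ α :=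
    Real.rpow_le_rpow (mul_nonneg (by linarith) hHz0.le) hb hα.le
  have h2 : ((a - u x t) * Hf u (x, t)) ^ α ≤ M ^ α / κ := by
    have : ((a - u z0.1 z0.2) * Hf u z0) ^ α / κ ≤ M ^ α / κ := by gcongr
    linarith
  have h3 : M ^ α / κ = (M * κ ^ (-1 / α)) ^ α := by
    rw [Real.mul_rpow hM0 (by positivity), ← Real.rpow_mul hκ.le,
      div_mul_cancel₀ _ hα.ne', Real.rpow_neg_one, div_eq_mul_inv]
  rw [h3] at h2
  exact (Real.rpow_le_rpow_iff (mul_nonneg (by linarith) hHz.le) (by positivity) hα).1 h2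

end
end

/-- Localized upper bound on the mean curvature for the graphical
`H^α`-flow (with `b = 0`), with a constant depending only on `n`, `α`, `a`, `w̲`. -/
theorem localized_upper_H_bound (n : ℕ) (hn : 1 ≤ n) (α a wlow : ℝ)
    (hα : 0 < α) (ha : 0 < a) (hwlow : wlow ∈ Set.Ioc (0:ℝ) (1/2)) :
    ∃ C : ℝ, 0 < C ∧
      ∀ T : ℝ, 0 < T → ∀ U : Set (En n), IsOpen U → ∀ u : En n → ℝ → ℝ,
        ContDiffOn ℝ (⊤ : ℕ∞) (fun p : En n × ℝ => u p.1 p.2) (U ×ˢ Set.Icc 0 T) →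
        (∀ x ∈ U, ∀ t ∈ Set.Icc (0:ℝ) T, 0 ≤ u x t) →
        (∀ t ∈ Set.Icc (0:ℝ) T, IsCompact {x ∈ U | u x t ≤ a}) →
        (∀ x ∈ U, ∀ t ∈ Set.Icc (0:ℝ) T, u x t < a + 1 →
          0 < meanCurv (fun y => u y t) x ∧
          deriv (u x) t = graphV (fun y => u y t) x * meanCurv (fun y => u y t) x ^ α) →
        (∀ x ∈ U, ∀ t ∈ Set.Icc (0:ℝ) T, 0 < psiF a 0 u x t → 2 * wlow ≤ wF u x t) →
        ∀ x ∈ U, ∀ t ∈ Set.Icc (0:ℝ) T, 0 < psiF a 0 u x t →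
          psiF a 0 u x t * meanCurv (fun y => u y t) x ≤
            C * max (sSup ((fun y => psiF a 0 u y 0 * meanCurv (fun z => u z 0) y) ''
                {y ∈ U | 0 < psiF a 0 u y 0})) 1 := by
  obtain ⟨hκ, -⟩ := hwlow
  refine ⟨max (Kc n α wlow) 1 * wlow ^ (-1 / α), by positivity, ?_⟩
  intro T hT U hU u hu _ hcomp hflow hw
  have hpsi : ∀ x t, psiF a 0 u x t = max (a - u x t) 0 := fun x t => by
    unfold psiF; rw [zero_mul, sub_zero]
  have hpsipos : ∀ x t, 0 < psiF a 0 u x t ↔ u x t < a := fun x t => by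
    rw [hpsi]; simp
  have hpsieq : ∀ x t, u x t < a → psiF a 0 u x t = a - u x t := fun x t h => by
    rw [hpsi, max_eq_left (by linarith)]
  have h0T : (0:ℝ) ∈ Set.Icc 0 T := ⟨le_rfl, hT.le⟩
  have hHs := (Hf_smooth hU hT u hu).continuousOn
  have hus := hu.continuousOn
  set S := (fun y => psiF a 0 u y 0 * meanCurv (fun z => u z 0) y) ''
                {y ∈ U | 0 < psiF a 0 u y 0} with hS
  have hbdd : BddAbove S := by
    have hK := hcomp 0 h0T
    have hc : ContinuousOn (fun y => psiF a 0 u y 0 * meanCurv (fun z => u z 0) y)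
        {x ∈ U | u x 0 ≤ a} := by
      have hmaps : Set.MapsTo (fun y : En n => ((y, 0) : En n × ℝ)) {x ∈ U | u x 0 ≤ a}
        (U ×ˢ Set.Icc 0 T) := fun y hy => ⟨hy.1, h0T⟩
      have hi : ContinuousOn (fun y : En n => ((y, 0) : En n × ℝ)) {x ∈ U | u x 0 ≤ a} := by
        fun_prop
      have c1 := ContinuousOn.comp (g := fun p : En n × ℝ => u p.1 p.2) hus hi hmaps
      have c2 := ContinuousOn.comp hHs hi hmaps
      simp only [hpsi]
      exact ((continuousOn_const.sub c1).sup continuousOn_const).mul c2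
    refine (hK.bddAbove_image hc).mono (Set.image_mono ?_)
    rintro y ⟨hy, hy2⟩
    exact ⟨hy, ((hpsipos y 0).1 hy2).le⟩
  set M := max (Kc n α wlow) 1 * max (sSup S) 1 with hMdef
  have m1 : 1 ≤ max (Kc n α wlow) 1 := le_max_right _ _
  have m2 : 1 ≤ max (sSup S) 1 := le_max_right _ _
  have hstep := step hα hκ hU hT u hu (hcomp 0 h0T)
    (fun z hz h => (hflow z.1 hz.1 z.2 hz.2 h).1) (fun z hz h => (hflow z.1 hz.1 z.2 hz.2 h).2)
    (fun z hz h => by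
      have h1 := hw z.1 hz.1 z.2 hz.2 ((hpsipos _ _).2 h)
      have h2 : wF u z.1 z.2 = 1 / vF (Pf u) z := rfl
      rw [h2, le_div_iff₀ (vF_pos _ _)] at h1
      linarith)
    M (fun y hy hya => by
      have h1 : (a - u y 0) * Hf u (y, 0) ≤ sSup S := by
        refine le_csSup hbdd ⟨y, ⟨hy, (hpsipos _ _).2 hya⟩, ?_⟩
        simp only [hpsieq y 0 hya]
        rfl
      have h2 : sSup S ≤ max (sSup S) 1 := le_max_left _ _
      nlinarith)
    (by
      have h2 : Kc n α wlow ≤ max (Kc n α wlow) 1 := le_max_left _ _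
      nlinarith) (by positivity)
  have hgoal : max (Kc n α wlow) 1 * wlow ^ (-1 / α) * max (sSup S) 1 = M * wlow ^ (-1 / α) := by
    rw [hMdef]; ring
  rw [hgoal]
  intro x hx t ht hpos
  have hxa := (hpsipos _ _).1 hpos
  rw [hpsieq x t hxa]
  rcases lt_or_eq_of_le ht.2 with h | h
  · exact hstep (x, t) ⟨hx, ht.1, h⟩ hxa
  · subst h
    have hmaps : Set.MapsTo (fun s : ℝ => ((x, s) : En n × ℝ)) (Set.Icc 0 t)
        (U ×ˢ Set.Icc 0 t) := fun s hs => ⟨hx, hs⟩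
    have hi : ContinuousOn (fun s : ℝ => ((x, s) : En n × ℝ)) (Set.Icc 0 t) := by fun_prop
    have c1 := ContinuousOn.comp (g := fun p : En n × ℝ => u p.1 p.2) hus hi hmaps
    have c2 := ContinuousOn.comp hHs hi hmaps
    have hle : nhdsWithin t (Set.Ioo 0 t) ≤ nhdsWithin t (Set.Icc 0 t) :=
      nhdsWithin_mono _ Set.Ioo_subset_Icc_self
    have t1 := (c1 t ht).mono_left hle
    have t2 := (c2 t ht).mono_left hle
    have hne : (nhdsWithin t (Set.Ioo 0 t)).NeBot := by
      rw [nhdsWithin_Ioo_eq_nhdsLT hT]; infer_instance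
    refine le_of_tendsto ((tendsto_const_nhds.sub t1).mul t2) ?_
    have hlt := t1.eventually (Iio_mem_nhds (show u x t < a from hxa))
    filter_upwards [hlt, self_mem_nhdsWithin] with s h1 h2
    exact hstep (x, s) ⟨hx, h2.1.le, h2.2⟩ h1
end
end
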